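/- Projective degrees for perfect ideals of height two: assume (i) ht(I) = 2 and I admits a graded free resolution (Hilbert–Burch) 0 → ⊕_{i=1}^n R(−δ−μ_i) →^φ R(−δ)^{n+1} → I → 0 with integers μ_1,…,μ_n ≥ 1, and (ii) I satisfies the condition G_{d+1}. Then for every 0 ≤ i ≤ d, the i-th projective degree of F : ℙ^d_k ⇢ ℙ^n_k is d_i(F) = e_{d−i}(μ_1,…,μ_n), the elementary symmetric polynomial ∑_{1≤j_1<⋯<j_{d−i}≤n} μ_{j_1}⋯μ_{j_{d−i}} (with e_0 = 1 and e_m = 0 for m > n). -/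

import Mathlib

section

variable {d : ℕ} (k : Type) [Field k]

/-- The bigraded Hilbert function of the Rees algebra of `I = (f₀,…,f_n)`:
`H(j,q) = dim_k [I^q]_{j+qδ}`. -/
noncomputable def reesHilbFn {n : ℕ} (δ : ℕ)
    (f : Fin (n + 1) → MvPolynomial (Fin (d + 1)) k) (j q : ℕ) : ℕ :=
  Module.finrank k
    ↥(((Ideal.span (Set.range f)) ^ q).restrictScalars k ⊓
      MvPolynomial.homogeneousSubmodule (Fin (d + 1)) k (j + q * δ))

/-- `P ∈ ℚ[u,v]` agrees with the bigraded function `H` for all `(j,q) ≫ (0,0)`. -/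
def IsBigradedHilbPoly (H : ℕ → ℕ → ℕ) (P : MvPolynomial (Fin 2) ℚ) : Prop :=
  ∃ j₀ q₀ : ℕ, ∀ j q : ℕ, j₀ ≤ j → q₀ ≤ q →
    MvPolynomial.eval ![(j : ℚ), (q : ℚ)] P = (H j q : ℚ)

/-- The `i`-th projective degree `d_i(F) = i!(d−i)!` times the coefficient of
`u^i v^{d-i}` in the bigraded Hilbert polynomial `P` of the Rees algebra. -/
noncomputable def projDeg (d : ℕ) (P : MvPolynomial (Fin 2) ℚ) (i : ℕ) : ℚ :=
  ((Nat.factorial i : ℚ) * (Nat.factorial (d - i) : ℚ)) *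
    MvPolynomial.coeff (Finsupp.single (0 : Fin 2) i + Finsupp.single (1 : Fin 2) (d - i)) P

/-- The height of an ideal: the infimum of the heights of the primes containing it. -/
noncomputable def idealHeight {R : Type} [CommRing R] (I : Ideal R) : ℕ∞ :=
  ⨅ (p : PrimeSpectrum R) (_ : I ≤ p.asIdeal), Order.height p

/-- The minimal number of generators of an ideal. -/
noncomputable def minGens {R : Type} [CommRing R] (I : Ideal R) : ℕ∞ :=
  ⨅ (s : Finset R) (_ : Ideal.span (s : Set R) = I), (s.card : ℕ∞)

/-- The condition `G_s`: `μ(I_𝔭) ≤ ht 𝔭` for every prime `𝔭 ⊇ I` with `ht 𝔭 < s`. -/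
def CondG (s : ℕ) {R : Type} [CommRing R] (I : Ideal R) : Prop :=
  ∀ p : PrimeSpectrum R, I ≤ p.asIdeal → Order.height p < (s : ℕ∞) →
    minGens (I.map (algebraMap R (Localization.AtPrime p.asIdeal))) ≤ Order.height p

end

/-- The minimal number of generators is attained when it is finite. -/
theorem exists_finset_card_le_of_minGens_le {R : Type} [CommRing R] {I : Ideal R} {m : ℕ∞}
    (hm : m ≠ ⊤) (h : minGens I ≤ m) :
    ∃ G : Finset R, (G.card : ℕ∞) ≤ m ∧ Ideal.span (G : Set R) = I := by
  by_contra! hG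
  have : m + 1 ≤ minGens I := le_iInf₂ fun G hGI => by
    rw [ENat.add_one_le_iff hm]
    by_contra! hc
    exact hG G hc hGI
  exact (ENat.lt_add_one_iff hm |>.mpr le_rfl).not_ge (this.trans h)

open IsLocalRing in
theorem IsRegularLocalRing.exists_mem_maximalIdeal_quotient {A : Type*} [CommRing A]
    [IsRegularLocalRing A] {D : ℕ} (hD : ringKrullDim A = (D + 1 : ℕ)) :
    ∃ x ∈ maximalIdeal A, (∀ p ∈ minimalPrimes A, x ∉ p) ∧
      IsRegularLocalRing (A ⧸ Ideal.span {x}) ∧ ringKrullDim (A ⧸ Ideal.span {x}) = D := by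
  classical
  have hreg := (isRegularLocalRing_iff A).mp ‹_›
  rw [hD] at hreg
  have hrank : (maximalIdeal A).spanFinrank = D + 1 := by exact_mod_cast hreg
  have hht : (maximalIdeal A).height = (D + 1 : ℕ) := by
    have := maximalIdeal_height_eq_ringKrullDim (R := A)
    rw [hD] at this; exact_mod_cast this
  have hfg := (maximalIdeal A).fg_of_isNoetherianRing
  have hsq : ¬ maximalIdeal A ≤ maximalIdeal A ^ 2 := by
    intro h
    have : maximalIdeal A = ⊥ := by
      refine Submodule.eq_bot_of_le_smul_of_le_jacobson_bot (maximalIdeal A) _ hfg ?_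
        (maximalIdeal_le_jacobson _)
      simpa [pow_two] using h
    rw [this, Submodule.spanFinrank_bot] at hrank
    omega
  have hmin : ∀ p ∈ minimalPrimes A, ¬ maximalIdeal A ≤ p := by
    intro p hp h
    have := hp.1.1
    have h0 := Ideal.height_eq_zero_iff.mpr hp
    have := Ideal.height_mono h
    rw [h0, hht] at this
    simp at this
  obtain ⟨x, hxm, hx⟩ : ∃ x ∈ maximalIdeal A,
      x ∉ ⋃ p ∈ insert (maximalIdeal A ^ 2) (minimalPrimes A), (p : Set A) := by
    by_contra! hcon
    obtain ⟨p, hp, hle⟩ := (Ideal.subset_union_prime_finite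
      ((minimalPrimes.finite_of_isNoetherianRing A).insert (maximalIdeal A ^ 2)) (f := id)
      (maximalIdeal A ^ 2) (maximalIdeal A ^ 2)
      (fun p hp hne _ => by
        rcases hp with rfl | hp
        · exact absurd rfl hne
        · exact hp.1.1)).mp hcon
    rcases hp with rfl | hp
    · exact hsq hle
    · exact hmin _ hp hle
  simp only [Set.mem_insert_iff, Set.iUnion_iUnion_eq_or_left, Set.mem_union, Set.mem_iUnion,
    not_or, not_exists, SetLike.mem_coe] at hx
  refine ⟨x, hxm, hx.2, ?_⟩
  have hne : Ideal.span {x} ≠ (⊤ : Ideal A) := fun h =>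
    (Ideal.IsPrime.ne_top inferInstance : maximalIdeal A ≠ ⊤)
      (top_le_iff.mp (h ▸ (Ideal.span_singleton_le_iff_mem _).mpr hxm))
  have : Nontrivial (A ⧸ Ideal.span {x}) := Ideal.Quotient.nontrivial_iff.mpr hne
  have : IsLocalRing (A ⧸ Ideal.span {x}) :=
    .of_surjective' (Ideal.Quotient.mk (Ideal.span {x})) Ideal.Quotient.mk_surjective
  have hmap : (maximalIdeal A).map (Ideal.Quotient.mk (Ideal.span {x})) =
      maximalIdeal (A ⧸ Ideal.span {x}) := by
    exact map_maximalIdeal_of_surjective _ Ideal.Quotient.mk_surjective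
  obtain ⟨s, hs, hspan⟩ := Submodule.FG.exists_span_finset_card_eq_spanFinrank hfg
  have hle : (maximalIdeal (A ⧸ Ideal.span {x})).spanFinrank ≤ D := by
    have hxs : x ∈ Submodule.span A (s : Set A) := hspan ▸ hxm
    obtain ⟨c, -, hc⟩ := Submodule.mem_span_finset.mp hxs
    obtain ⟨a, has, hca⟩ : ∃ a ∈ s, c a ∉ maximalIdeal A := by
      by_contra! hcon
      refine hx.1 (hc ▸ Ideal.sum_mem _ fun a ha => ?_)
      rw [pow_two]
      exact Ideal.mul_mem_mul (hcon a ha) (hspan ▸ Submodule.subset_span ha)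
    have hu : IsUnit (c a) := by simpa using hca
    have hgen : maximalIdeal (A ⧸ Ideal.span {x}) =
        Ideal.span (((s.erase a).image (Ideal.Quotient.mk (Ideal.span {x})) : Finset _) :
          Set (A ⧸ Ideal.span {x})) := by
      rw [← hmap, ← hspan]
      change Ideal.map _ (Ideal.span _) = _
      rw [Ideal.map_span]
      apply le_antisymm
      · rw [Ideal.span_le]
        rintro _ ⟨b, hb, rfl⟩
        by_cases hba : b = a
        · subst hba
          rw [← Finset.add_sum_erase _ _ has] at hc
          have h1 : Ideal.Quotient.mk (Ideal.span {x}) (c b * b) =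
              - ∑ y ∈ s.erase b, Ideal.Quotient.mk (Ideal.span {x}) (c y * y) := by
            rw [eq_neg_iff_add_eq_zero, ← map_sum, ← map_add]
            rw [Ideal.Quotient.eq_zero_iff_mem]
            simp only [smul_eq_mul] at hc
            rw [hc]; exact Ideal.mem_span_singleton_self x
          rw [map_mul] at h1
          rw [SetLike.mem_coe, ← Ideal.unit_mul_mem_iff_mem _
            (hu.map (Ideal.Quotient.mk (Ideal.span {x}))), h1]
          refine neg_mem (Ideal.sum_mem _ fun y hy => ?_)
          rw [map_mul]
          exact Ideal.mul_mem_left _ _ (Ideal.subset_span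
            (by simpa using ⟨y, by simpa [and_comm] using hy, rfl⟩))
        · exact Ideal.subset_span (by
            simp only [Finset.coe_image, Set.mem_image]
            exact ⟨b, by simp [hba]; exact hb, rfl⟩)
      · exact Ideal.span_mono (by
          simp only [Finset.coe_image]
          exact Set.image_mono (by simp))
    rw [hgen]
    refine (Submodule.spanFinrank_span_le_ncard_of_finite (Finset.finite_toSet _)).trans ?_
    rw [Set.ncard_coe_finset]
    refine Finset.card_image_le.trans ?_
    rw [Finset.card_erase_of_mem has, hs, hrank]; simp
  have hdim : (D : WithBot ℕ∞) ≤ ringKrullDim (A ⧸ Ideal.span {x}) := by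
    have := Ideal.height_le_ringKrullDim_quotient_add_one hxm
    rw [hht] at this
    push_cast at this
    exact ENat.WithBot.add_le_add_one_right_iff.mp this
  have hreg' : IsRegularLocalRing (A ⧸ Ideal.span {x}) :=
    .of_spanFinrank_maximalIdeal_le _ (le_trans (by exact_mod_cast hle) hdim)
  exact ⟨hreg', le_antisymm (((isRegularLocalRing_iff _).mp hreg') ▸ by exact_mod_cast hle) hdim⟩

open IsLocalRing RingTheory.Sequence Pointwise in
theorem IsRegularLocalRing.isDomain_and_exists_isWeaklyRegular (D : ℕ) :
    ∀ (A : Type) [CommRing A] [IsRegularLocalRing A], ringKrullDim A = D →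
      IsDomain A ∧ ∃ rs : List A, rs.length = D ∧ (∀ r ∈ rs, r ∈ maximalIdeal A) ∧
        IsWeaklyRegular A rs := by
  induction D with
  | zero =>
    intro A _ _ hD
    have hreg := (isRegularLocalRing_iff A).mp ‹_›
    rw [hD] at hreg
    have hrank : (maximalIdeal A).spanFinrank = 0 := by exact_mod_cast hreg
    have hbot : maximalIdeal A = ⊥ := (Submodule.spanFinrank_eq_zero_iff_eq_bot
      (maximalIdeal A).fg_of_isNoetherianRing).mp hrank
    refine ⟨?_, [], rfl, by simp, by simp⟩
    have := (isField_iff_maximalIdeal_eq.mpr hbot)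
    exact this.isDomain
  | succ D ih =>
    intro A _ _ hD
    obtain ⟨x, hxm, hxmin, hreg, hdim⟩ := exists_mem_maximalIdeal_quotient hD
    obtain ⟨hdom, rs, hlen, hmem, hrs⟩ := ih (A ⧸ Ideal.span {x}) hdim
    have hprime : (Ideal.span {x}).IsPrime := (Ideal.Quotient.isDomain_iff_prime _).mp hdom
    obtain ⟨q, hq, hqx⟩ := Ideal.exists_minimalPrimes_le (bot_le : (⊥ : Ideal A) ≤ Ideal.span {x})
    have hqp : q.IsPrime := hq.1.1
    have hqbot : q = ⊥ := by
      refine Submodule.eq_bot_of_le_smul_of_le_jacobson_bot (maximalIdeal A) _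
        q.fg_of_isNoetherianRing ?_ (maximalIdeal_le_jacobson _)
      intro a ha
      obtain ⟨b, rfl⟩ := Ideal.mem_span_singleton'.mp (hqx ha)
      rw [mul_comm]
      exact Ideal.mul_mem_mul hxm ((hqp.mem_or_mem ha).resolve_right (hxmin q hq))
    have hdomA : IsDomain A := by
      have : (⊥ : Ideal A).IsPrime := hqbot ▸ hqp
      exact IsDomain.of_bot_isPrime A
    have hx0 : x ≠ 0 := fun h => hxmin q hq (h ▸ q.zero_mem)
    choose! lift hlift using Ideal.Quotient.mk_surjective (I := Ideal.span {x})
    refine ⟨hdomA, x :: rs.map lift, by simp [hlen], ?_, ?_⟩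
    · intro r hr
      rcases List.mem_cons.mp hr with rfl | hr
      · exact hxm
      · obtain ⟨y, hy, rfl⟩ := List.mem_map.mp hr
        have hy' := hmem y hy
        rw [← hlift y] at hy'
        rw [mem_maximalIdeal, mem_nonunits_iff] at hy' ⊢
        exact fun hu => hy' (hu.map (Ideal.Quotient.mk (Ideal.span {x})))
    · rw [isWeaklyRegular_cons_iff']
      refine ⟨IsSMulRegular.of_ne_zero hx0, ?_⟩
      · have : (rs.map lift).map (Ideal.Quotient.mk (Ideal.span {x})) = rs := by
          rw [List.map_map]
          conv_rhs => rw [← List.map_id rs]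
          exact List.map_congr_left fun a _ => hlift a
        rw [this]
        have hspan : (Ideal.span {x} : Ideal A) = x • (⊤ : Submodule A A) := by
          rw [← Submodule.ideal_span_singleton_smul, smul_eq_mul, Ideal.mul_top]
        let e : (A ⧸ Ideal.span {x}) ≃ₗ[A] QuotSMulTop x A := Submodule.quotEquivOfEq _ _ hspan
        refine (AddEquiv.isWeaklyRegular_congr (e := e.toAddEquiv)
          (List.forall₂_same.mpr fun r _ y => ?_)).mp hrs
        obtain ⟨r, rfl⟩ := Ideal.Quotient.mk_surjective r
        exact e.map_smul r y

/-- If every prime of the form `J : t` with `t ∈ T` contains `𝔞`, then a power of `𝔞` multiplies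
`T` into `J`. -/
theorem Ideal.exists_pow_mul_le_of_forall_colon {S : Type*} [CommRing S] [IsNoetherianRing S]
    {J T 𝔞 : Ideal S}
    (h : ∀ Q : Ideal S, Q.IsPrime → ∀ t ∈ T, (∀ s, s ∈ Q ↔ s * t ∈ J) → 𝔞 ≤ Q) :
    ∃ N : ℕ, 𝔞 ^ N * T ≤ J := by
  let M := Submodule.map J.mkQ T
  have hrad : 𝔞 ≤ (Module.annihilator S M).radical := by
    rw [← Ideal.sInf_minimalPrimes]
    refine le_sInf fun Q hQ => ?_
    have hass := Module.associatedPrimes.minimalPrimes_annihilator_subset_associatedPrimes S M hQ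
    rw [AssociatedPrimes.mem_iff, isAssociatedPrime_iff] at hass
    obtain ⟨hQp, ⟨_, t, ht, rfl⟩, hQt⟩ := hass
    refine h Q hQp t ht fun s => ?_
    rw [hQt, Submodule.mem_colon_singleton, Submodule.mem_bot, ← Subtype.coe_inj]
    change s • J.mkQ t = 0 ↔ _
    rw [← map_smul, Submodule.mkQ_apply, Submodule.Quotient.mk_eq_zero, smul_eq_mul]
  obtain ⟨N, hN⟩ := Ideal.exists_pow_le_of_le_radical_of_fg_radical hrad
    (Ideal.fg_of_isNoetherianRing _)
  refine ⟨N, Ideal.mul_le.mpr fun a ha t ht => ?_⟩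
  have := Module.mem_annihilator.mp (hN ha) ⟨J.mkQ t, t, ht, rfl⟩
  rw [← Subtype.coe_inj] at this
  change a • J.mkQ t = 0 at this
  rwa [← map_smul, Submodule.mkQ_apply, Submodule.Quotient.mk_eq_zero, smul_eq_mul] at this

section Depth

open IsLocalRing RingTheory.Sequence CategoryTheory Abelian Limits ModuleCat

/-- Dividing out a weakly regular sequence lowers the range in which the `Ext` groups from the
residue field vanish by at most its length. -/
theorem IsLocalRing.mem_smul_top_of_isWeaklyRegular {A : Type} [CommRing A] [IsLocalRing A]
    (rs : List A) : ∀ (M : ModuleCat.{0} A), IsWeaklyRegular M rs →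
      (∀ i ≤ rs.length, Subsingleton (Ext (ModuleCat.of A (ResidueField A)) M i)) →
      ∀ y : M, (∀ a ∈ maximalIdeal A, a • y ∈ (Ideal.ofList rs • ⊤ : Submodule A M)) →
        y ∈ (Ideal.ofList rs • ⊤ : Submodule A M) := by
  induction rs with
  | nil =>
    intro M _ hext y hy
    have h0 := hext 0 le_rfl
    have hhom : Subsingleton (ResidueField A →ₗ[A] M) :=
      ((Ext.addEquiv₀ (X := ModuleCat.of A (ResidueField A)) (Y := M)).trans
        ModuleCat.homAddEquiv).symm.subsingleton
    simp only [Ideal.ofList_nil, Submodule.bot_smul, Submodule.mem_bot] at hy ⊢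
    let g : (A ⧸ maximalIdeal A) →ₗ[A] M :=
      Submodule.liftQ (maximalIdeal A) (LinearMap.toSpanSingleton A M y) fun a ha =>
        hy a ha
    have hg : g (Submodule.Quotient.mk 1) = y := one_smul A y
    have hzero : g = 0 := hhom.elim (g : ResidueField A →ₗ[A] M) 0
    rw [← hg, hzero]
    rfl
  | cons x rs ih =>
    intro M hM hext y hy
    obtain ⟨hx, hrs⟩ := (isWeaklyRegular_cons_iff M x rs).mp hM
    have key := ih (ModuleCat.of A (QuotSMulTop x M)) hrs (fun i hi => by
      have zero1 := AddCommGrpCat.isZero_of_iff_subsingleton.mpr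
        (hext i (by simp only [List.length_cons]; omega))
      have zero2 := AddCommGrpCat.isZero_of_iff_subsingleton.mpr
        (hext (i + 1) (by simp only [List.length_cons]; omega))
      exact AddCommGrpCat.subsingleton_of_isZero <| ShortComplex.Exact.isZero_of_both_zeros
        ((Ext.covariant_sequence_exact₃' _ hx.smulShortComplex_shortExact) i (i + 1) rfl)
        (zero1.eq_zero_of_src _) (zero2.eq_zero_of_tgt _)) (Submodule.Quotient.mk y)
    let e := Submodule.quotOfListConsSMulTopEquivQuotSMulTopInner M x rs
    have he : ∀ z : M, (Submodule.Quotient.mk z : QuotSMulTop x M) ∈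
        (Ideal.ofList rs • ⊤ : Submodule A (QuotSMulTop x M)) ↔
          z ∈ (Ideal.ofList (x :: rs) • ⊤ : Submodule A M) := by
      intro z
      rw [← Submodule.Quotient.mk_eq_zero (Ideal.ofList (x :: rs) • ⊤ : Submodule A M),
        ← e.map_eq_zero_iff, ← Submodule.Quotient.mk_eq_zero]
      rfl
    exact (he y).mp (key fun a ha => (he (a • y)).mpr (hy a ha))

/-- A weakly regular sequence of length less than the dimension of a regular local ring generates
an ideal whose associated primes do not contain the maximal ideal. -/
theorem IsRegularLocalRing.mem_ofList_of_isWeaklyRegular {A : Type} [CommRing A]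
    [IsRegularLocalRing A] {D : ℕ}
    (hD : ringKrullDim A = D) {rs : List A} (hlen : rs.length < D)
    (hrs : IsWeaklyRegular A rs) {y : A}
    (hy : ∀ a ∈ maximalIdeal A, a * y ∈ Ideal.ofList rs) : y ∈ Ideal.ofList rs := by
  obtain ⟨-, xs, hxlen, hxmem, hxs⟩ := isDomain_and_exists_isWeaklyRegular D A hD
  have hreg : IsRegular A xs :=
    IsRegular.of_isWeaklyRegular_of_mem_maximalIdeal _ hxmem hxs
  have hext := ModuleCat.subsingleton_ext_of_exists_isRegular (maximalIdeal A)
    (ModuleCat.of A (ResidueField A)) (by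
      rw [Module.support_eq_zeroLocus]
      refine PrimeSpectrum.zeroLocus_anti_mono (Ideal.annihilator_quotient.symm.le))
    (ModuleCat.of A A) (by
      simpa using (maximalIdeal.isMaximal A).ne_top.lt_top) xs hxmem hreg
  have := mem_smul_top_of_isWeaklyRegular rs (ModuleCat.of A A) hrs
    (fun i hi => hext i (by omega)) y
  simp only [smul_eq_mul, Ideal.mul_top] at this
  exact this hy

end Depth

open RingTheory.Sequence in
theorem RingTheory.Sequence.isWeaklyRegular_of_mul_mem {A : Type*} [CommRing A] {rs : List A}
    (h : ∀ l (hl : l < rs.length), ∀ a, rs[l] * a ∈ Ideal.ofList (rs.take l) →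
      a ∈ Ideal.ofList (rs.take l)) : IsWeaklyRegular A rs := by
  refine ⟨fun l hl => ?_⟩
  rw [isSMulRegular_quotient_iff_mem_of_smul_mem]
  simpa only [smul_eq_mul, Ideal.mul_top] using h l hl

/-- If away from `V(𝔞)` the initial segments of `rs` have at least the expected height, then
away from `V(𝔞)` they are unmixed, and each element is regular modulo its predecessors. -/
theorem IsRegularRing.unmixed_and_exists_pow_mul_mem {S : Type} [CommRing S] [IsRegularRing S]
    {𝔞 : Ideal S} {rs : List S}
    (hht : ∀ i ≤ rs.length, ∀ Q : Ideal S, Q.IsPrime → Ideal.ofList (rs.take i) ≤ Q → ¬ 𝔞 ≤ Q →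
      (i : ℕ∞) ≤ Q.height) (i : ℕ) :
    (i ≤ rs.length → ∀ Q : Ideal S, Q.IsPrime → ∀ t,
      (∀ s, s ∈ Q ↔ s * t ∈ Ideal.ofList (rs.take i)) → ¬ 𝔞 ≤ Q → Q.height ≤ i) ∧
    ∀ hi : i < rs.length, ∃ N : ℕ, ∀ w ∈ 𝔞 ^ N, ∀ t,
      rs[i] * t ∈ Ideal.ofList (rs.take i) → w * t ∈ Ideal.ofList (rs.take i) := by
  induction i using Nat.strong_induction_on with
  | _ i ih =>
  have hfirst : i ≤ rs.length → ∀ Q : Ideal S, Q.IsPrime → ∀ t,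
      (∀ s, s ∈ Q ↔ s * t ∈ Ideal.ofList (rs.take i)) → ¬ 𝔞 ≤ Q → Q.height ≤ i := by
    intro hi Q hQ t hQt haQ
    by_contra! hlt
    obtain ⟨D, hD⟩ := ENat.ne_top_iff_exists.mp (Ideal.height_ne_top_of_isPrime (I := Q))
    let A := Localization.AtPrime Q
    have hdim : ringKrullDim A = D := by
      rw [IsLocalization.AtPrime.ringKrullDim_eq_height Q, ← hD]; rfl
    have hmem : ∀ (K : Ideal S) (a : S), algebraMap S A a ∈ K.map (algebraMap S A) →
        ∃ u ∉ Q, u * a ∈ K := by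
      intro K a ha
      have := (IsLocalization.algebraMap_mem_map_algebraMap_iff Q.primeCompl A K a).mp ha
      obtain ⟨u, hu, hua⟩ := this
      exact ⟨u, hu, hua⟩
    have hunit : ∀ u ∉ Q, IsUnit (algebraMap S A u) := fun u hu =>
      IsLocalization.map_units A (⟨u, hu⟩ : Q.primeCompl)
    obtain ⟨w, hwa, hwQ⟩ := SetLike.not_le_iff_exists.mp haQ
    have htQ : algebraMap S A t ∈ Ideal.ofList ((rs.take i).map (algebraMap S A)) := by
      refine IsRegularLocalRing.mem_ofList_of_isWeaklyRegular hdim ?_ ?_ ?_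
      · have : (i : ℕ∞) < D := hD ▸ hlt
        simp only [List.length_map, List.length_take]
        have := Nat.cast_lt.mp this
        omega
      · refine RingTheory.Sequence.isWeaklyRegular_of_mul_mem fun l hl a ha => ?_
        simp only [List.length_map, List.length_take] at hl
        rw [← List.map_take, List.take_take, min_eq_left (by omega), ← Ideal.map_ofList] at ha ⊢
        simp only [List.getElem_map, List.getElem_take] at ha
        obtain ⟨⟨s, u⟩, hsu⟩ := IsLocalization.surj Q.primeCompl a
        obtain ⟨u', hu', hus⟩ := hmem (Ideal.ofList (rs.take l)) (rs[l] * s) (by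
          rw [map_mul, ← hsu, ← mul_assoc]
          exact Ideal.mul_mem_right _ _ ha)
        obtain ⟨N, hN⟩ := (ih l (by omega)).2 (by omega)
        have h1 := hN (w ^ N) (Ideal.pow_mem_pow hwa N) (u' * s) (by
          rwa [mul_left_comm])
        have h2 := Ideal.mem_map_of_mem (algebraMap S A) h1
        rw [map_mul, map_mul, ← hsu,
          Ideal.unit_mul_mem_iff_mem _ (hunit _ fun h => hwQ (hQ.mem_of_pow_mem _ h)),
          Ideal.unit_mul_mem_iff_mem _ (hunit _ hu'),
          Ideal.mul_unit_mem_iff_mem _ (hunit _ u.2)] at h2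
        exact h2
      · intro a ha
        obtain ⟨⟨s, u⟩, hsu⟩ := IsLocalization.surj Q.primeCompl a
        have hs : s ∈ Q := by
          by_contra hs
          have h3 : a * algebraMap S A u ∈ IsLocalRing.maximalIdeal A := Ideal.mul_mem_right _ _ ha
          rw [hsu] at h3
          exact (IsLocalRing.mem_maximalIdeal _).mp h3 (hunit s hs)
        have := Ideal.mem_map_of_mem (algebraMap S A) ((hQt s).mp hs)
        rw [map_mul, ← hsu, mul_assoc, mul_left_comm,
          Ideal.unit_mul_mem_iff_mem _ (hunit _ u.2), Ideal.map_ofList] at this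
        exact this
    rw [← Ideal.map_ofList] at htQ
    obtain ⟨u, hu, hut⟩ := hmem _ _ htQ
    exact hu ((hQt u).mpr hut)
  refine ⟨hfirst, fun hi => ?_⟩
  obtain ⟨N, hN⟩ := Ideal.exists_pow_mul_le_of_forall_colon (J := Ideal.ofList (rs.take i))
    (T := (Ideal.ofList (rs.take i)).colon {rs[i]}) (𝔞 := 𝔞) (by
      intro Q hQ t ht hQt
      by_contra haQ
      have hle : Ideal.ofList (rs.take (i + 1)) ≤ Q := by
        rw [← List.take_append_getElem hi, Ideal.ofList_append, sup_le_iff, Ideal.ofList_singleton,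
          Ideal.span_singleton_le_iff_mem]
        refine ⟨fun a ha => (hQt a).mpr (Ideal.mul_mem_right _ _ ha), (hQt _).mpr ?_⟩
        have := Submodule.mem_colon_singleton.mp ht
        rwa [smul_eq_mul, mul_comm] at this
      have h1 := hht (i + 1) hi Q hQ hle haQ
      have h2 := h1.trans (hfirst hi.le Q hQ t hQt haQ)
      have := Nat.cast_le.mp h2
      omega)
  refine ⟨N, fun w hw t ht => hN (Ideal.mul_mem_mul hw ?_)⟩
  rw [Submodule.mem_colon_singleton, smul_eq_mul, mul_comm]
  exact ht

section

open MvPolynomial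

/-- A prime of a polynomial ring over a domain containing `s` variables has height at least
`s.card`. -/
theorem MvPolynomial.card_le_height_of_forall_X_mem {K ι : Type*} [CommRing K] [IsDomain K]
    [DecidableEq ι] (s : Finset ι) (Q : Ideal (MvPolynomial ι K)) [Q.IsPrime]
    (hs : ∀ i ∈ s, X i ∈ Q) : (s.card : ℕ∞) ≤ Q.height := by
  let θ (s : Finset ι) : MvPolynomial ι K →ₐ[K] MvPolynomial ι K :=
    aeval fun i => if i ∈ s then 0 else X i
  have hθp (s : Finset ι) : (RingHom.ker (θ s)).IsPrime := RingHom.ker_isPrime _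
  have hcard : (s.card : ℕ∞) ≤ (RingHom.ker (θ s)).height := by
    clear hs
    induction s using Finset.induction_on with
    | empty => simp
    | insert a s ha ih =>
      rw [Finset.card_insert_of_notMem ha, Nat.cast_add_one]
      refine (add_le_add_left ih 1).trans (Ideal.height_add_one_le_of_lt_of_isPrime ?_)
      refine SetLike.lt_iff_le_and_exists.mpr ⟨?_, X a, by simp [θ], by simp [θ, ha]⟩
      have hcomp : θ (insert a s) = (θ (insert a s)).comp (θ s) := by
        ext i : 1
        by_cases hi : i ∈ s <;> simp [θ, hi]
      intro F hF
      rw [RingHom.mem_ker] at hF ⊢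
      rw [hcomp, AlgHom.comp_apply, hF, map_zero]
  refine hcard.trans (Ideal.height_mono fun F hF => ?_)
  have hcomp : (Ideal.Quotient.mkₐ K Q) = (Ideal.Quotient.mkₐ K Q).comp (θ s) := by
    ext i : 1
    by_cases hi : i ∈ s
    · simpa [θ, hi] using Ideal.Quotient.eq_zero_iff_mem.mpr (hs i hi)
    · simp [θ, hi]
  rw [← Ideal.Quotient.eq_zero_iff_mem]
  change Ideal.Quotient.mkₐ K Q F = 0
  rw [hcomp, AlgHom.comp_apply, (RingHom.mem_ker).mp hF, map_zero]

/-- A prime of a polynomial ring over a field containing `r` independent linear forms has height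
at least `r`. -/
theorem MvPolynomial.card_le_height_of_linearIndependent {K σ ι : Type*} [Field K] [Fintype σ]
    [Fintype ι] {v : ι → σ → K} (hv : LinearIndependent K v) (Q : Ideal (MvPolynomial σ K))
    [Q.IsPrime] (hQ : ∀ i, ∑ a, C (v i a) * X a ∈ Q) : (Fintype.card ι : ℕ∞) ≤ Q.height := by
  classical
  let b := Module.Basis.sumExtend hv
  let e := (SymmetricAlgebra.equivMvPolynomial b).symm.trans
    (SymmetricAlgebra.equivMvPolynomial (Pi.basisFun K σ))
  have he (i : ι) : e (X (Sum.inl i)) = ∑ a, C (v i a) * X a := by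
    have hbi : b (Sum.inl i) = ∑ a, v i a • Pi.basisFun K σ a := by
      have hb : b (Sum.inl i) = v i := by
        simp [b, Module.Basis.sumExtend]
        rfl
      ext c
      simp [hb, Pi.single_apply]
    simp only [e, AlgEquiv.trans_apply, SymmetricAlgebra.equivMvPolynomial_symm_X, hbi, map_sum,
      map_smul, SymmetricAlgebra.equivMvPolynomial_ι_apply, smul_eq_C_mul]
  have := card_le_height_of_forall_X_mem (Finset.univ.image Sum.inl) (Q.comap e.toRingEquiv)
    (by
      intro i hi
      obtain ⟨j, -, rfl⟩ := Finset.mem_image.mp hi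
      rw [Ideal.mem_comap]
      change e _ ∈ Q
      rw [he]
      exact hQ j)
  rwa [RingEquiv.height_comap, Finset.card_image_of_injective _ Sum.inl_injective,
    Finset.card_univ] at this

attribute [local instance] MvPolynomial.algebraMvPolynomial in
theorem MvPolynomial.card_le_height_of_linearIndependent_of_comap_eq_bot {B σ ι : Type*}
    [CommRing B] [IsDomain B] [Fintype σ] [Fintype ι] {v : ι → σ → B}
    (hv : LinearIndependent B v) (Q : Ideal (MvPolynomial σ B)) [Q.IsPrime]
    (hbot : Q.comap C = ⊥) (hQ : ∀ i, ∑ a, C (v i a) * X a ∈ Q) :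
    (Fintype.card ι : ℕ∞) ≤ Q.height := by
  let K := FractionRing B
  let M := (nonZeroDivisors B).map (C (σ := σ) (R := B))
  have hloc : IsLocalization M (MvPolynomial σ K) := MvPolynomial.isLocalization _ _
  have hdisj : Disjoint (M : Set (MvPolynomial σ B)) (Q : Set _) := by
    rw [Set.disjoint_left]
    rintro _ ⟨c, hc, rfl⟩ hcQ
    have : c ∈ Q.comap C := hcQ
    rw [hbot, Ideal.mem_bot] at this
    exact nonZeroDivisors.ne_zero hc this
  rw [← IsLocalization.height_map_of_disjoint (S := MvPolynomial σ K) M Q hdisj]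
  have := IsLocalization.isPrime_of_isPrime_disjoint M (MvPolynomial σ K) Q ‹_› hdisj
  have hvK : LinearIndependent K fun i a => algebraMap B K (v i a) := by
    rw [← LinearIndependent.iff_fractionRing B K]
    exact hv.map_injOn ((Algebra.linearMap B K).compLeft σ)
      (((IsFractionRing.injective B K).comp_left).injOn)
  refine card_le_height_of_linearIndependent hvK _ fun i => ?_
  have hmap : algebraMap (MvPolynomial σ B) (MvPolynomial σ K) (∑ a, C (v i a) * X a) =
      ∑ a, C (algebraMap B K (v i a)) * X a := by
    rw [MvPolynomial.algebraMap_def, map_sum]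
    simp only [map_mul, map_C, map_X]
  rw [← hmap]
  exact Ideal.mem_map_of_mem _ (hQ i)

/-- If the prime `Q` of `R[y]` contains linear forms which are independent modulo `p = Q ∩ R`, then
the height of `Q` exceeds that of `p` by at least their number. -/
theorem MvPolynomial.height_add_card_le_height {R σ ι : Type*} [CommRing R] [IsNoetherianRing R]
    [Fintype σ] [Fintype ι] (Q : Ideal (MvPolynomial σ R)) [Q.IsPrime] (p : Ideal R) [p.IsPrime]
    (hp : Q.comap C = p) {v : ι → σ → R}
    (hv : LinearIndependent (R ⧸ p) fun i a => Ideal.Quotient.mk p (v i a))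
    (hQ : ∀ i, ∑ a, C (v i a) * X a ∈ Q) :
    p.height + (Fintype.card ι : ℕ∞) ≤ Q.height := by
  have : Q.LiesOver p := ⟨hp.symm⟩
  rw [Ideal.height_eq_height_add_of_liesOver_of_hasGoingDown p Q]
  refine add_le_add_right ?_ _
  let π := Ideal.Quotient.mk (p.map (algebraMap R (MvPolynomial σ R)))
  have hker : RingHom.ker π ≤ Q := by
    rw [Ideal.mk_ker, Ideal.map_le_iff_le_comap]
    exact hp.symm.le
  have hprime : (Q.map π).IsPrime :=
    Ideal.map_isPrime_of_surjective Ideal.Quotient.mk_surjective hker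
  have hmem (F) : π F ∈ Q.map π ↔ F ∈ Q := by
    rw [← Ideal.mem_comap, Ideal.comap_map_of_surjective π Ideal.Quotient.mk_surjective,
      ← RingHom.ker_eq_comap_bot, sup_eq_left.mpr hker]
  let e : MvPolynomial σ (R ⧸ p) ≃+*
      MvPolynomial σ R ⧸ p.map (algebraMap R (MvPolynomial σ R)) :=
    (quotientEquivQuotientMvPolynomial (σ := σ) p).toRingEquiv
  have heC (c : R) : e (C (Ideal.Quotient.mk p c)) = π (C c) := by
    exact (eval₂_C _ _ _).trans (Ideal.Quotient.lift_mk _ _ _)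
  have heX (a : σ) : e (X a) = π (X a) := by
    exact eval₂_X _ _ _
  refine le_of_le_of_eq ?_ (RingEquiv.height_comap e (Q.map π))
  have hprime' : (Ideal.comap e (Q.map π)).IsPrime := Ideal.comap_isPrime _ _
  refine card_le_height_of_linearIndependent_of_comap_eq_bot hv _ ?_ fun i => ?_
  · rw [eq_bot_iff]
    intro c hc
    obtain ⟨c, rfl⟩ := Ideal.Quotient.mk_surjective c
    rw [Ideal.mem_comap, Ideal.mem_comap, heC, hmem] at hc
    rw [Ideal.mem_bot, Ideal.Quotient.eq_zero_iff_mem, ← hp]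
    exact hc
  · rw [Ideal.mem_comap, map_sum]
    simp only [map_mul, heC, heX]
    simp only [← map_mul, ← map_sum, hmem]
    exact hQ i

end

section

open MvPolynomial

/-- If an ideal of a local ring is generated by `f` and also by the finite set `G`, then the
residues of the syzygies of `f` span a space of codimension at most `G.card`. -/
theorem IsLocalRing.card_le_finrank_add_card {A ι : Type*} [CommRing A] [IsLocalRing A] [Fintype ι]
    (f : ι → A) (G : Finset A) (hG : Ideal.span (G : Set A) = Ideal.span (Set.range f))
    (N : Submodule (IsLocalRing.ResidueField A) (ι → IsLocalRing.ResidueField A))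
    (hN : ∀ v : ι → A, ∑ j, v j * f j = 0 → (fun j => IsLocalRing.residue A (v j)) ∈ N) :
    Fintype.card ι ≤ Module.finrank (IsLocalRing.ResidueField A) N + G.card := by
  classical
  have hf (j : ι) : ∃ c : A → A, ∑ g ∈ G, c g * g = f j := by
    have : f j ∈ Ideal.span (G : Set A) := hG ▸ Ideal.subset_span ⟨j, rfl⟩
    obtain ⟨c, -, hc⟩ := Submodule.mem_span_finset.mp this
    exact ⟨c, hc⟩
  choose c hc using hf
  let M : Matrix G ι A := fun g j => c j g
  let L := (M.map (IsLocalRing.residue A)).mulVecLin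
  have hker : LinearMap.ker L ≤ N := by
    intro v hv
    choose u hu using fun j => IsLocalRing.residue_surjective (v j)
    have hmem (g : G) : ∑ j, c j g * u j ∈ IsLocalRing.maximalIdeal A := by
      rw [← IsLocalRing.residue_eq_zero_iff, map_sum]
      have h : ∑ j, IsLocalRing.residue A (c j g) * v j = 0 := congrFun (LinearMap.mem_ker.mp hv) g
      simpa only [map_mul, hu] using h
    have hmem' : ∑ j, u j * f j ∈ IsLocalRing.maximalIdeal A • Ideal.span (Set.range f) := by
      have : ∑ j, u j * f j = ∑ g : G, (∑ j, c j g * u j) * (g : A) := by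
        simp_rw [Finset.sum_mul]
        rw [Finset.sum_comm]
        refine Finset.sum_congr rfl fun j _ => ?_
        rw [← hc j, Finset.mul_sum, ← Finset.sum_coe_sort G]
        exact Finset.sum_congr rfl fun g _ => by ring
      rw [this]
      refine Ideal.sum_mem _ fun g _ => ?_
      exact Submodule.smul_mem_smul (hmem g) (hG ▸ Ideal.subset_span g.2)
    obtain ⟨w, hw, hwf⟩ := (Submodule.mem_ideal_smul_span_iff_exists_sum _ _ _).mp hmem'
    rw [Finsupp.sum_fintype _ _ (by simp)] at hwf
    have := hN (fun j => u j - w j) (by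
      simp only [sub_mul, Finset.sum_sub_distrib]
      rw [← hwf]; simp)
    convert this using 2 with j
    rw [map_sub, hu, (IsLocalRing.residue_eq_zero_iff _).mpr (hw j), sub_zero]
  have h1 := L.finrank_range_add_finrank_ker
  have h2 := Submodule.finrank_le (LinearMap.range L)
  have h3 := Submodule.finrank_mono hker
  simp only [Module.finrank_fintype_fun_eq_card, Fintype.card_coe] at h1 h2
  omega

/-- If the columns of `φ` generate the syzygies of `f` over a domain and `(f)` localized at `p` is
generated by the finite set `G`, then at least `m - G.card` columns of `φ` are independent
modulo `p`. -/
theorem Ideal.exists_linearIndepOn_columns {R ι β : Type*} [CommRing R] [IsDomain R] [Fintype ι]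
    [Fintype β] (f : ι → R) (φ : Matrix ι β R)
    (hφ : ∀ v : ι → R, ∑ j, v j * f j = 0 → ∃ w, φ.mulVec w = v) (p : Ideal R) [p.IsPrime]
    (G : Finset (Localization.AtPrime p))
    (hG : Ideal.span (G : Set (Localization.AtPrime p)) =
      (Ideal.span (Set.range f)).map (algebraMap R (Localization.AtPrime p))) :
    ∃ B : Finset β, Fintype.card ι ≤ B.card + G.card ∧
      LinearIndepOn (R ⧸ p) (fun b a => Ideal.Quotient.mk p (φ a b)) (B : Set β) := by
  classical
  let A := Localization.AtPrime p
  let κ := IsLocalRing.ResidueField A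
  let v : β → ι → κ := fun b a => IsLocalRing.residue A (algebraMap R A (φ a b))
  obtain ⟨B, hB, hmax⟩ := exists_maximal_linearIndepOn κ v
  have hspan : Submodule.span κ (Set.range v) = Submodule.span κ (v '' B) := by
    refine le_antisymm (Submodule.span_le.mpr ?_) (Submodule.span_mono (Set.image_subset_range _ _))
    rintro _ ⟨b, rfl⟩
    by_cases hb : b ∈ B
    · exact Submodule.subset_span ⟨b, hb, rfl⟩
    · obtain ⟨a, ha, hab⟩ := hmax b hb
      exact (Submodule.smul_mem_iff _ ha).mp hab
  have hcard := IsLocalRing.card_le_finrank_add_card (A := A) (fun j => algebraMap R A (f j)) G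
    (by rw [hG, Ideal.map_span, ← Set.range_comp]; rfl) (Submodule.span κ (Set.range v)) (by
      intro u hu
      obtain ⟨s, hs⟩ := IsLocalization.exist_integer_multiples_of_finite p.primeCompl u
      choose t ht using hs
      obtain ⟨w, hw⟩ := hφ t (by
        apply IsLocalization.injective A p.primeCompl_le_nonZeroDivisors
        simp only [map_sum, map_mul, ht, map_zero, Algebra.smul_def, mul_assoc]
        rw [← Finset.mul_sum, hu, mul_zero])
      have hs0 : IsLocalRing.residue A (algebraMap R A s) ≠ 0 :=
        ((IsLocalization.map_units A s).map (IsLocalRing.residue A)).ne_zero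
      rw [← Submodule.smul_mem_iff _ hs0]
      have : (IsLocalRing.residue A (algebraMap R A s) • fun j => IsLocalRing.residue A (u j)) =
          ∑ b, IsLocalRing.residue A (algebraMap R A (w b)) • v b := by
        ext a
        have h1 := ht a
        rw [← hw, Algebra.smul_def] at h1
        simp only [Pi.smul_apply, smul_eq_mul, ← map_mul, ← h1, Finset.sum_apply, v, Matrix.mulVec,
          dotProduct, map_sum]
        simp only [mul_comm]
      rw [this]
      exact Submodule.sum_mem _ fun b _ => Submodule.smul_mem _ _ (Submodule.subset_span ⟨b, rfl⟩))
  rw [hspan, Set.image_eq_range, finrank_span_eq_card hB] at hcard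
  refine ⟨B.toFinset, by rwa [Set.toFinset_card], ?_⟩
  rw [Set.coe_toFinset]
  let π : R ⧸ p →+* κ := Ideal.Quotient.lift p
    ((IsLocalRing.residue A).comp (algebraMap R A)) fun a ha => by
      rw [RingHom.comp_apply, IsLocalRing.residue_eq_zero_iff]
      exact (IsLocalization.AtPrime.to_map_mem_maximal_iff A p a).mpr ha
  have hπ : Function.Injective π := by
    rw [injective_iff_map_eq_zero]
    intro a ha
    obtain ⟨a, rfl⟩ := Ideal.Quotient.mk_surjective a
    rw [Ideal.Quotient.eq_zero_iff_mem]
    rw [Ideal.Quotient.lift_mk, RingHom.comp_apply, IsLocalRing.residue_eq_zero_iff] at ha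
    exact (IsLocalization.AtPrime.to_map_mem_maximal_iff A p a).mp ha
  rw [LinearIndepOn, Fintype.linearIndependent_iff] at hB ⊢
  intro g hg b
  refine (map_eq_zero_iff π hπ).mp (hB (fun b => π (g b)) ?_ b)
  ext a
  simpa [π, v] using congrArg π (congrFun hg a)

end

theorem LinearIndependent.exists_det_ne_zero {D ι β : Type*} [CommRing D] [IsDomain D] [Fintype ι]
    [Fintype β] [DecidableEq β] {w : β → ι → D} (hw : LinearIndependent D w) :
    ∃ a : β → ι, (Matrix.of fun b c => w b (a c)).det ≠ 0 := by
  classical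
  let K := FractionRing D
  let W : Matrix β ι K := fun b i => algebraMap D K (w b i)
  have hW : LinearIndependent K W.row := by
    rw [← LinearIndependent.iff_fractionRing D K]
    exact hw.map_injOn ((Algebra.linearMap D K).compLeft ι)
      (((IsFractionRing.injective D K).comp_left).injOn)
  obtain ⟨s, a, ha, hspan, hs⟩ := exists_linearIndependent' K W.col
  have : Fintype s := Fintype.ofInjective a ha
  have hcard : Fintype.card s = Fintype.card β := by
    rw [← finrank_span_eq_card hs, hspan, ← Matrix.rank_eq_finrank_span_cols, hW.rank_matrix]
  let e := Fintype.equivOfCardEq hcard.symm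
  refine ⟨a ∘ e, fun h0 => ?_⟩
  have h1 : LinearIndependent K (Matrix.of fun b c => W b (a (e c))).col :=
    hs.comp e e.injective
  rw [Matrix.linearIndependent_cols_iff_isUnit, Matrix.isUnit_iff_isUnit_det] at h1
  refine h1.ne_zero ?_
  rw [← map_zero (algebraMap D K), ← h0, RingHom.map_det]
  rfl

attribute [local instance] MvPolynomial.gradedAlgebra in
/-- If the columns of a matrix with homogeneous columns are independent modulo the largest
homogeneous ideal contained in the prime `p`, then they are independent modulo `p`. -/
theorem MvPolynomial.linearIndependent_of_homogeneousCore {k τ ι β : Type*} [Field k] [Fintype ι]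
    [Fintype β] {φ : Matrix ι β (MvPolynomial τ k)} {μ : β → ℕ}
    (hφ : ∀ a b, (φ a b).IsHomogeneous (μ b)) (p : Ideal (MvPolynomial τ k)) [p.IsPrime]
    (h : LinearIndependent
      (MvPolynomial τ k ⧸ (p.homogeneousCore (homogeneousSubmodule τ k)).toIdeal)
      fun b a => Ideal.Quotient.mk (p.homogeneousCore (homogeneousSubmodule τ k)).toIdeal (φ a b)) :
    LinearIndependent (MvPolynomial τ k ⧸ p) fun b a => Ideal.Quotient.mk p (φ a b) := by
  classical
  have := Ideal.IsPrime.homogeneousCore (𝒜 := homogeneousSubmodule τ k) ‹p.IsPrime›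
  obtain ⟨a, ha⟩ := h.exists_det_ne_zero
  let M : Matrix β β (MvPolynomial τ k) := Matrix.of fun b c => φ (a c) b
  have hM : M.det.IsHomogeneous (∑ b, μ b) := by
    rw [← Matrix.det_transpose, Matrix.det_apply]
    refine IsHomogeneous.sum _ _ _ fun σ _ => ?_
    refine (homogeneousSubmodule τ k _).smul_of_tower_mem _ ?_
    exact IsHomogeneous.prod _ _ _ fun b _ => hφ _ _
  have hMp : M.det ∉ p := fun hp => ha <| by
    have := Ideal.Quotient.eq_zero_iff_mem.mpr
      (Ideal.mem_homogeneousCore_of_homogeneous_of_mem (𝒜 := homogeneousSubmodule τ k) ⟨_, hM⟩ hp)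
    rwa [RingHom.map_det] at this
  have hdet : (M.map (Ideal.Quotient.mk p)).det ≠ 0 := by
    change ((Ideal.Quotient.mk p).mapMatrix M).det ≠ 0
    rw [← RingHom.map_det]
    exact fun h0 => hMp (Ideal.Quotient.eq_zero_iff_mem.mp h0)
  have := Matrix.linearIndependent_rows_of_det_ne_zero hdet
  exact LinearIndependent.of_comp (LinearMap.funLeft _ _ a) this

section

open MvPolynomial

attribute [local instance] MvPolynomial.gradedAlgebra in
theorem MvPolynomial.height_homogeneousCore_le {k : Type*} [Field k] {d : ℕ}
    (p : Ideal (MvPolynomial (Fin (d + 1)) k)) [p.IsPrime]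
    (hp : ¬ idealOfVars (Fin (d + 1)) k ≤ p) :
    (p.homogeneousCore (homogeneousSubmodule (Fin (d + 1)) k)).toIdeal.height ≤ d := by
  set p₀ := p.homogeneousCore (homogeneousSubmodule (Fin (d + 1)) k) with hp₀
  have : p₀.toIdeal.IsPrime :=
    Ideal.IsPrime.homogeneousCore (𝒜 := homogeneousSubmodule (Fin (d + 1)) k) ‹p.IsPrime›
  let m : Ideal (MvPolynomial (Fin (d + 1)) k) := RingHom.ker (constantCoeff (R := k))
  have hm : m.IsPrime := RingHom.ker_isPrime _
  have hXm : idealOfVars (Fin (d + 1)) k ≤ m := by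
    rw [idealOfVars, Ideal.span_le]
    rintro _ ⟨i, rfl⟩
    exact RingHom.mem_ker.mpr (constantCoeff_X _ i)
  have hlt : p₀.toIdeal < m := by
    refine lt_of_le_of_ne (fun F hF => ?_) fun h => hp ?_
    · by_contra hFm
      have h0 := p₀.isHomogeneous 0 hF
      rw [show (DirectSum.decompose (homogeneousSubmodule (Fin (d + 1)) k) F 0 :
        MvPolynomial (Fin (d + 1)) k) = homogeneousComponent 0 F from
          decomposition.decompose'_apply F 0, homogeneousComponent_zero] at h0
      exact ‹p₀.toIdeal.IsPrime›.ne_top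
        (Ideal.eq_top_of_isUnit_mem _ h0 ((isUnit_iff_ne_zero.mpr hFm).map C))
    · exact hXm.trans (h.symm.le.trans (Ideal.toIdeal_homogeneousCore_le _ _))
  have h1 := Ideal.height_add_one_le_of_lt_of_isPrime hlt
  have h2 : m.height ≤ ((d + 1 : ℕ) : WithBot ℕ∞) := by
    refine (Ideal.height_le_ringKrullDim_of_ne_top hm.ne_top).trans ?_
    rw [MvPolynomial.ringKrullDim_of_isNoetherianRing]
    simp
  have h3 : p₀.toIdeal.height + 1 ≤ (d : ℕ∞) + 1 := h1.trans (by exact_mod_cast h2)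
  exact (ENat.add_le_add_iff_right (by simp)).mp h3

attribute [local instance] MvPolynomial.gradedAlgebra in
/-- Primes of `k[x][y]` which contain some of the linear forms defined by the columns of the
syzygy matrix of `f`, but do not contain all of the variables `x`, have the expected height when
`f` satisfies `G_{d+1}`. -/
theorem MvPolynomial.card_le_height_of_columns_mem {k : Type*} [Field k] {d n : ℕ}
    (f : Fin (n + 1) → MvPolynomial (Fin (d + 1)) k)
    {φ : Matrix (Fin (n + 1)) (Fin n) (MvPolynomial (Fin (d + 1)) k)} {μ : Fin n → ℕ}
    (hφdeg : ∀ a b, (φ a b).IsHomogeneous (μ b))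
    (hφ : ∀ v : Fin (n + 1) → MvPolynomial (Fin (d + 1)) k,
      ∑ j, v j * f j = 0 → ∃ w, φ.mulVec w = v)
    (hG : ∀ p : Ideal (MvPolynomial (Fin (d + 1)) k), ∀ _ : p.IsPrime,
      Ideal.span (Set.range f) ≤ p → p.height ≤ d →
      ∃ G : Finset (Localization.AtPrime p), (G.card : ℕ∞) ≤ p.height ∧
        Ideal.span (G : Set (Localization.AtPrime p)) =
          (Ideal.span (Set.range f)).map (algebraMap _ (Localization.AtPrime p)))
    (Q : Ideal (MvPolynomial (Fin (n + 1)) (MvPolynomial (Fin (d + 1)) k))) [Q.IsPrime]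
    (hQm : ¬ (idealOfVars (Fin (d + 1)) k).map C ≤ Q) (B₀ : Finset (Fin n))
    (hQ : ∀ b ∈ B₀, ∑ a, C (φ a b) * X a ∈ Q) :
    (B₀.card : ℕ∞) ≤ Q.height ∧ (Q.comap C ≠ ⊥ → (B₀.card : ℕ∞) + 1 ≤ Q.height) := by
  classical
  set p := Q.comap C with hpQ
  have hp : p.IsPrime := Ideal.comap_isPrime C Q
  rw [Ideal.map_le_iff_le_comap] at hQm
  have hd := height_homogeneousCore_le p hQm
  set p₀ := (p.homogeneousCore (homogeneousSubmodule (Fin (d + 1)) k)).toIdeal with hp₀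
  have hp₀p : p₀ ≤ p := Ideal.toIdeal_homogeneousCore_le _ _
  have : p₀.IsPrime :=
    Ideal.IsPrime.homogeneousCore (𝒜 := homogeneousSubmodule (Fin (d + 1)) k) hp
  have key (G : Finset (Localization.AtPrime p₀))
      (hG : Ideal.span (G : Set (Localization.AtPrime p₀)) =
          (Ideal.span (Set.range f)).map (algebraMap _ (Localization.AtPrime p₀))) :
      ∃ r : ℕ, B₀.card + 1 ≤ r + G.card ∧ p.height + r ≤ Q.height := by
    obtain ⟨B, hB, hind⟩ := Ideal.exists_linearIndepOn_columns f φ hφ p₀ G hG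
    refine ⟨(B ∩ B₀).card, ?_, ?_⟩
    · have h1 := Finset.card_union_add_card_inter B B₀
      have h2 := Finset.card_le_univ (B ∪ B₀)
      simp only [Fintype.card_fin] at h2 hB
      omega
    · have h1 := hind.mono (Finset.coe_subset.mpr (Finset.inter_subset_left (s₂ := B₀)))
      have h2 := linearIndependent_of_homogeneousCore
        (φ := φ.submatrix id (Subtype.val : ↥(B ∩ B₀) → Fin n)) (μ := fun b => μ b)
        (fun a b => hφdeg a b) p h1
      have h3 := height_add_card_le_height Q p rfl
        (v := fun (b : ↥(B ∩ B₀)) a => φ a b) h2 fun b => hQ b (Finset.mem_inter.mp b.2).2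
      rwa [Fintype.card_coe] at h3
  by_cases hI : Ideal.span (Set.range f) ≤ p₀
  · obtain ⟨G, hGc, hGs⟩ := hG p₀ this hI hd
    obtain ⟨r, hr, hrQ⟩ := key G hGs
    have : (B₀.card : ℕ∞) + 1 ≤ Q.height := calc
      (B₀.card : ℕ∞) + 1 ≤ (r + G.card : ℕ) := by exact_mod_cast hr
      _ = G.card + r := by push_cast; rw [add_comm]
      _ ≤ p.height + r := add_le_add_left (hGc.trans (Ideal.height_mono hp₀p)) _
      _ ≤ Q.height := hrQ
    exact ⟨le_self_add.trans this, fun _ => this⟩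
  · obtain ⟨r, hr, hrQ⟩ := key {1} (by
      obtain ⟨F, hF, hFp⟩ := SetLike.not_le_iff_exists.mp hI
      rw [Finset.coe_singleton, Ideal.span_singleton_one]
      symm
      exact Ideal.eq_top_of_isUnit_mem _ (Ideal.mem_map_of_mem _ hF)
        (IsLocalization.map_units (Localization.AtPrime p₀) (⟨F, hFp⟩ : p₀.primeCompl)))
    rw [Finset.card_singleton, add_le_add_iff_right] at hr
    have hr' : (B₀.card : ℕ∞) ≤ r := by exact_mod_cast hr
    refine ⟨hr'.trans (le_add_self.trans hrQ), fun hne => ?_⟩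
    rw [add_comm]
    refine (add_le_add ?_ hr').trans hrQ
    rw [Order.one_le_iff_ne_zero, Ne, Ideal.height_eq_zero_iff_eq_bot]
    exact hne

end

section

open MvPolynomial

theorem Ideal.exists_pow_inf_le_of_pow_mul_le {A : Type*} [CommRing A] [IsNoetherianRing A]
    {𝔞 T J : Ideal A} {N : ℕ} (h : 𝔞 ^ N * T ≤ J) : ∃ j, 𝔞 ^ j ⊓ T ≤ J := by
  obtain ⟨c, hc⟩ := Ideal.exists_pow_inf_eq_pow_smul 𝔞 (M := A) T
  refine ⟨N + c, ?_⟩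
  have := hc (N + c) (by omega)
  rw [smul_eq_mul, Ideal.mul_top, Nat.add_sub_cancel] at this
  rw [this]
  exact (Ideal.mul_mono_right inf_le_right).trans h

namespace BigradedSym

/-- The bigraded polynomial ring `k[y₀,…,yₙ,x₀,…,x_d]`. -/
abbrev BiPoly (k : Type) [Field k] (d n : ℕ) : Type := MvPolynomial (Fin (n + 1) ⊕ Fin (d + 1)) k

variable {k : Type} [Field k] {d n : ℕ}

/-- The linear form in `y` with coefficients the `b`-th column of `φ`. -/
noncomputable def columnForm (φ : Matrix (Fin (n + 1)) (Fin n) (MvPolynomial (Fin (d + 1)) k))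
    (b : Fin n) : BiPoly k d n :=
  ∑ a, rename Sum.inr (φ a b) * X (Sum.inl a)

/-- The ideal generated by the linear forms of the columns of index less than `i`. -/
noncomputable def columnIdeal (φ : Matrix (Fin (n + 1)) (Fin n) (MvPolynomial (Fin (d + 1)) k))
    (i : ℕ) : Ideal (BiPoly k d n) :=
  Ideal.span (columnForm φ '' {b | (b : ℕ) < i})

variable (k d n) in
/-- The ideal generated by the variables `x`. -/
noncomputable def xIdeal : Ideal (BiPoly k d n) :=
  Ideal.span (Set.range fun i => X (Sum.inr i))

theorem ofList_take_ofFn_columnForm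
    (φ : Matrix (Fin (n + 1)) (Fin n) (MvPolynomial (Fin (d + 1)) k)) (i : ℕ) :
    Ideal.ofList ((List.ofFn (columnForm φ)).take i) = columnIdeal φ i := by
  rw [Ideal.ofList, columnIdeal]
  congr 1
  ext F
  simp only [Set.mem_ofPred_eq, Set.mem_image, List.mem_take_iff_getElem, List.length_ofFn,
    List.getElem_ofFn]
  constructor
  · rintro ⟨j, hj, rfl⟩
    exact ⟨⟨j, by omega⟩, by simp; omega, rfl⟩
  · rintro ⟨b, hb, rfl⟩
    exact ⟨b, by omega, rfl⟩

variable {f : Fin (n + 1) → MvPolynomial (Fin (d + 1)) k}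
    {φ : Matrix (Fin (n + 1)) (Fin n) (MvPolynomial (Fin (d + 1)) k)} {μ : Fin n → ℕ}

theorem le_height_of_columnIdeal_le
    (hφdeg : ∀ a b, (φ a b).IsHomogeneous (μ b))
    (hφ : ∀ v : Fin (n + 1) → MvPolynomial (Fin (d + 1)) k,
      ∑ j, v j * f j = 0 → ∃ w, φ.mulVec w = v)
    (hG : ∀ p : Ideal (MvPolynomial (Fin (d + 1)) k), ∀ _ : p.IsPrime,
      Ideal.span (Set.range f) ≤ p → p.height ≤ d →
      ∃ G : Finset (Localization.AtPrime p), (G.card : ℕ∞) ≤ p.height ∧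
        Ideal.span (G : Set (Localization.AtPrime p)) =
          (Ideal.span (Set.range f)).map (algebraMap _ (Localization.AtPrime p)))
    {i : ℕ} (hi : i ≤ n) (Q : Ideal (BiPoly k d n)) [Q.IsPrime]
    (hQ : columnIdeal φ i ≤ Q) (hxQ : ¬ xIdeal k d n ≤ Q) :
    (i : ℕ∞) ≤ Q.height ∧
      (Q.comap (rename (R := k) Sum.inr) ≠ ⊥ → (i : ℕ∞) + 1 ≤ Q.height) := by
  let e := (sumAlgEquiv k (Fin (n + 1)) (Fin (d + 1))).toRingEquiv.symm
  let Q' := Q.comap e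
  have heC (F) : e (C F) = rename Sum.inr F := by
    have := DFunLike.congr_fun (sumAlgEquiv_comp_rename_inr k (Fin (n + 1)) (Fin (d + 1))) F
    exact (RingEquiv.symm_apply_eq _).mpr this.symm
  have heX (a) : e (X a) = X (Sum.inl a) := sumAlgEquiv_symm_X _ _ _ _
  have hQ' : Q'.IsPrime := Ideal.comap_isPrime e Q
  have := card_le_height_of_columns_mem f hφdeg hφ hG Q' ?_
    (Finset.univ.filter fun b : Fin n => (b : ℕ) < i) ?_
  · rw [RingEquiv.height_comap, Fin.card_filter_val_lt, min_eq_right hi] at this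
    convert this using 5
    ext F
    simp only [Ideal.mem_comap, Q', heC]
  · rw [Ideal.map_le_iff_le_comap, idealOfVars, Ideal.span_le]
    intro h
    refine hxQ (Ideal.span_le.mpr ?_)
    rintro _ ⟨c, rfl⟩
    have := h ⟨c, rfl⟩
    simpa only [SetLike.mem_coe, Ideal.mem_comap, Q', heC, rename_X] using this
  · intro b hb
    rw [Ideal.mem_comap, map_sum]
    simp only [map_mul, heC, heX]
    exact hQ (Ideal.subset_span ⟨b, by simpa using hb, rfl⟩)

/-- In large `x`-degree each column form is a nonzerodivisor modulo the preceding ones. -/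
theorem exists_mem_columnIdeal_of_mul_mem
    (hφdeg : ∀ a b, (φ a b).IsHomogeneous (μ b))
    (hφ : ∀ v : Fin (n + 1) → MvPolynomial (Fin (d + 1)) k,
      ∑ j, v j * f j = 0 → ∃ w, φ.mulVec w = v)
    (hG : ∀ p : Ideal (MvPolynomial (Fin (d + 1)) k), ∀ _ : p.IsPrime,
      Ideal.span (Set.range f) ≤ p → p.height ≤ d →
      ∃ G : Finset (Localization.AtPrime p), (G.card : ℕ∞) ≤ p.height ∧
        Ideal.span (G : Set (Localization.AtPrime p)) =
          (Ideal.span (Set.range f)).map (algebraMap _ (Localization.AtPrime p)))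
    (i : Fin n) :
    ∃ j, ∀ t ∈ xIdeal k d n ^ j, columnForm φ i * t ∈ columnIdeal φ i → t ∈ columnIdeal φ i := by
  obtain ⟨N, hN⟩ := (IsRegularRing.unmixed_and_exists_pow_mul_mem (𝔞 := xIdeal k d n)
    (rs := List.ofFn (columnForm φ)) (by
      intro l hl Q hQ hlQ hxQ
      rw [ofList_take_ofFn_columnForm] at hlQ
      rw [List.length_ofFn] at hl
      exact (le_height_of_columnIdeal_le hφdeg hφ hG hl Q hlQ hxQ).1) i).2 (by simp)
  simp only [ofList_take_ofFn_columnForm, List.getElem_ofFn, Fin.eta] at hN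
  obtain ⟨j, hj⟩ := Ideal.exists_pow_inf_le_of_pow_mul_le (𝔞 := xIdeal k d n) (N := N)
    (T := (columnIdeal φ i).colon {columnForm φ i}) (J := columnIdeal φ i) (by
      rw [Ideal.mul_le]
      intro w hw t ht
      refine hN w hw t ?_
      rw [mul_comm]
      exact Submodule.mem_colon_singleton.mp ht)
  refine ⟨j, fun t ht hmul => hj ⟨ht, Submodule.mem_colon_singleton.mpr ?_⟩⟩
  rwa [smul_eq_mul, mul_comm]

/-- In large `x`-degree the symmetric algebra has no torsion with respect to `h`. -/
theorem exists_mem_columnIdeal_of_pow_mul_mem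
    (hφdeg : ∀ a b, (φ a b).IsHomogeneous (μ b))
    (hφ : ∀ v : Fin (n + 1) → MvPolynomial (Fin (d + 1)) k,
      ∑ j, v j * f j = 0 → ∃ w, φ.mulVec w = v)
    (hG : ∀ p : Ideal (MvPolynomial (Fin (d + 1)) k), ∀ _ : p.IsPrime,
      Ideal.span (Set.range f) ≤ p → p.height ≤ d →
      ∃ G : Finset (Localization.AtPrime p), (G.card : ℕ∞) ≤ p.height ∧
        Ideal.span (G : Set (Localization.AtPrime p)) =
          (Ideal.span (Set.range f)).map (algebraMap _ (Localization.AtPrime p)))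
    {h : MvPolynomial (Fin (d + 1)) k} (hh : h ≠ 0) :
    ∃ j, ∀ t ∈ xIdeal k d n ^ j, ∀ N, rename Sum.inr h ^ N * t ∈ columnIdeal φ n →
      t ∈ columnIdeal φ n := by
  let T : Ideal (BiPoly k d n) :=
    ⨆ N, (columnIdeal φ n).colon {(rename Sum.inr h : BiPoly k d n) ^ N}
  have hT (t : BiPoly k d n) : t ∈ T ↔ ∃ N, rename Sum.inr h ^ N * t ∈ columnIdeal φ n := by
    rw [Submodule.mem_iSup_of_directed]
    · simp only [Submodule.mem_colon_singleton, smul_eq_mul, mul_comm]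
    · refine Monotone.directed_le fun N N' hN t ht => ?_
      rw [Submodule.mem_colon_singleton, smul_eq_mul] at ht ⊢
      obtain ⟨c, rfl⟩ := Nat.exists_eq_add_of_le hN
      rw [pow_add, ← mul_assoc]
      exact Ideal.mul_mem_right _ _ ht
  obtain ⟨N, hN⟩ := Ideal.exists_pow_mul_le_of_forall_colon (J := columnIdeal φ n) (T := T)
    (𝔞 := xIdeal k d n) (by
      intro Q hQ t ht hQt
      by_contra hxQ
      have hle : columnIdeal φ n ≤ Q := fun s hs => (hQt s).mpr (Ideal.mul_mem_right _ _ hs)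
      have h1 := (IsRegularRing.unmixed_and_exists_pow_mul_mem (𝔞 := xIdeal k d n)
        (rs := List.ofFn (columnForm φ)) (by
          intro l hl Q hQ hlQ hxQ
          rw [ofList_take_ofFn_columnForm] at hlQ
          rw [List.length_ofFn] at hl
          exact (le_height_of_columnIdeal_le hφdeg hφ hG hl Q hlQ hxQ).1) n).1 (by simp) Q hQ t
        (by simpa only [ofList_take_ofFn_columnForm] using hQt) hxQ
      obtain ⟨N, hN⟩ := (hT t).mp ht
      have h2 := (le_height_of_columnIdeal_le hφdeg hφ hG le_rfl Q hle hxQ).2 (by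
        intro hbot
        have : h ∈ Q.comap (rename (R := k) Sum.inr) :=
          hQ.mem_of_pow_mem N ((hQt _).mpr hN)
        rw [hbot] at this
        exact hh this)
      have h3 := h2.trans h1
      norm_cast at h3
      omega)
  obtain ⟨j, hj⟩ := Ideal.exists_pow_inf_le_of_pow_mul_le hN
  exact ⟨j, fun t ht N hN => hj ⟨ht, (hT t).mpr ⟨N, hN⟩⟩⟩

end BigradedSym

end

theorem Submodule.finrank_map_add_finrank_inf_ker {K V W : Type*} [Field K] [AddCommGroup V]
    [Module K V] [AddCommGroup W] [Module K W] (U : Submodule K V) [FiniteDimensional K U]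
    (L : V →ₗ[K] W) :
    Module.finrank K (U.map L) + Module.finrank K ↥(U ⊓ LinearMap.ker L) = Module.finrank K U := by
  have h := (L.domRestrict U).finrank_range_add_finrank_ker
  rwa [LinearMap.range_domRestrict, LinearMap.ker_domRestrict,
    ← Submodule.finrank_map_subtype_eq U, Submodule.map_comap_subtype] at h

/-- The effect on Hilbert functions of adding to a homogeneous ideal `J` a homogeneous element `g`
which is a nonzerodivisor modulo `J` in a given degree. -/
theorem GradedAlgebra.finrank_sup_span_inf {K S ι : Type*} [Field K] [CommRing S] [Algebra K S]
    [DecidableEq ι] [AddCancelCommMonoid ι] (𝒜 : ι → Submodule K S) [GradedAlgebra 𝒜]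
    [∀ i, FiniteDimensional K (𝒜 i)] {J : Ideal S} (hJ : J.IsHomogeneous 𝒜) {g : S} {m e : ι}
    (hg : g ∈ 𝒜 m) (h : ∀ t ∈ 𝒜 e, g * t ∈ J → t ∈ J) :
    Module.finrank K ↥((J ⊔ Ideal.span {g}).restrictScalars K ⊓ 𝒜 (m + e)) +
        Module.finrank K ↥(J.restrictScalars K ⊓ 𝒜 e) =
      Module.finrank K ↥(J.restrictScalars K ⊓ 𝒜 (m + e)) + Module.finrank K (𝒜 e) := by
  let π : S →ₗ[K] S ⧸ J := J.mkQ.restrictScalars K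
  have hπ (s : S) : π s = 0 ↔ s ∈ J := Submodule.Quotient.mk_eq_zero J
  let L : S →ₗ[K] S ⧸ J := π ∘ₗ LinearMap.mulLeft K g
  have h1 := (𝒜 e).finrank_map_add_finrank_inf_ker L
  have : FiniteDimensional K ↥((J ⊔ Ideal.span {g}).restrictScalars K ⊓ 𝒜 (m + e)) :=
    Submodule.finiteDimensional_of_le inf_le_right
  have h2 := ((J ⊔ Ideal.span {g}).restrictScalars K ⊓ 𝒜 (m + e)).finrank_map_add_finrank_inf_ker π
  have e1 : 𝒜 e ⊓ LinearMap.ker L = J.restrictScalars K ⊓ 𝒜 e := by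
    ext t
    simp only [Submodule.mem_inf, LinearMap.mem_ker, L, LinearMap.comp_apply, hπ,
      LinearMap.mulLeft_apply, Submodule.restrictScalars_mem]
    exact ⟨fun ht => ⟨h t ht.1 ht.2, ht.1⟩, fun ht => ⟨ht.2, J.mul_mem_left _ ht.1⟩⟩
  have e2 : (J ⊔ Ideal.span {g}).restrictScalars K ⊓ 𝒜 (m + e) ⊓ LinearMap.ker π =
      J.restrictScalars K ⊓ 𝒜 (m + e) := by
    ext t
    simp only [Submodule.mem_inf, LinearMap.mem_ker, hπ, Submodule.restrictScalars_mem]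
    exact ⟨fun ht => ⟨ht.2, ht.1.2⟩, fun ht => ⟨⟨Ideal.mem_sup_left ht.1, ht.2⟩, ht.1⟩⟩
  have e3 : ((J ⊔ Ideal.span {g}).restrictScalars K ⊓ 𝒜 (m + e)).map π = (𝒜 e).map L := by
    apply le_antisymm
    · rintro _ ⟨t, ⟨ht, htA⟩, rfl⟩
      obtain ⟨a, ha, b, hb, rfl⟩ := Submodule.mem_sup.mp ht
      obtain ⟨s, rfl⟩ := Ideal.mem_span_singleton'.mp hb
      refine ⟨DirectSum.decompose 𝒜 s e, SetLike.coe_mem _, ?_⟩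
      have h3 : a + s * g = DirectSum.decompose 𝒜 (a + s * g) (m + e) :=
        (DirectSum.decompose_of_mem_same 𝒜 htA).symm
      rw [h3, DirectSum.decompose_add, DirectSum.add_apply, Submodule.coe_add, mul_comm s,
        DirectSum.coe_decompose_mul_add_of_left_mem 𝒜 hg, map_add, (hπ _).mpr (hJ _ ha), zero_add]
      rfl
    · rintro _ ⟨t, ht, rfl⟩
      refine ⟨g * t, ⟨?_, SetLike.mul_mem_graded hg ht⟩, rfl⟩
      exact Ideal.mul_mem_right _ _ (Ideal.mem_sup_right (Ideal.mem_span_singleton_self g))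
  rw [e1] at h1
  rw [e2, e3] at h2
  omega

section

open MvPolynomial

namespace BigradedSym

/-- The weights giving the bigrading by `x`-degree and `y`-degree. -/
def bidegree (d n : ℕ) : Fin (n + 1) ⊕ Fin (d + 1) → ℕ × ℕ :=
  Sum.elim (fun _ => (0, 1)) fun _ => (1, 0)

variable (k : Type) [Field k] (d n : ℕ)

/-- The bihomogeneous polynomials of degree `e.1` in `x` and `e.2` in `y`. -/
noncomputable abbrev bihom (e : ℕ × ℕ) : Submodule k (BiPoly k d n) :=
  weightedHomogeneousSubmodule k (bidegree d n) e

noncomputable instance : GradedAlgebra (bihom k d n) :=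
  weightedGradedAlgebra k (bidegree d n)

variable {d n} in
theorem weight_bidegree (m : Fin (n + 1) ⊕ Fin (d + 1) →₀ ℕ) :
    Finsupp.weight (bidegree d n) m =
      (∑ i, m (Sum.inr i), ∑ a, m (Sum.inl a)) := by
  rw [Finsupp.weight_apply, Finsupp.sum_fintype _ _ (by simp), Fintype.sum_sum_type]
  simp [bidegree, Prod.ext_iff, Prod.fst_sum, Prod.snd_sum]

/-- The monomials of bidegree `(j,q)` are pairs of monomials of degrees `q` and `j`. -/
noncomputable def monomialEquiv (j q : ℕ) :
    {m : Fin (n + 1) ⊕ Fin (d + 1) →₀ ℕ | Finsupp.weight (bidegree d n) m = (j, q)} ≃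
      Finset.finsuppAntidiag (Finset.univ : Finset (Fin (n + 1))) q ×
        Finset.finsuppAntidiag (Finset.univ : Finset (Fin (d + 1))) j :=
  (Equiv.subtypeEquiv Finsupp.sumFinsuppEquivProdFinsupp (q := fun m =>
    m.1 ∈ Finset.finsuppAntidiag (Finset.univ : Finset (Fin (n + 1))) q ∧
    m.2 ∈ Finset.finsuppAntidiag (Finset.univ : Finset (Fin (d + 1))) j) (by
      intro m
      change Finsupp.weight (bidegree d n) m = (j, q) ↔ _
      rw [weight_bidegree, Finset.mem_finsuppAntidiag, Finset.mem_finsuppAntidiag]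
      simp [Prod.ext_iff, and_comm]
      rfl)).trans Equiv.subtypeProdEquivProd

instance (e : ℕ × ℕ) : FiniteDimensional k (bihom k d n e) := by
  have := Finite.of_equiv _ (monomialEquiv d n e.1 e.2).symm
  rw [bihom, weightedHomogeneousSubmodule_eq_finsupp_supported]
  exact Module.Finite.of_basis (basisRestrictSupport k
    {m : Fin (n + 1) ⊕ Fin (d + 1) →₀ ℕ | Finsupp.weight (bidegree d n) m = e})

theorem finrank_bihom (j q : ℕ) :
    Module.finrank k (bihom k d n (j, q)) = (j + d).choose d * (q + n).choose n := by
  rw [bihom, weightedHomogeneousSubmodule_eq_finsupp_supported]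
  have h := Module.finrank_eq_nat_card_basis
    (basisRestrictSupport k
    {m : Fin (n + 1) ⊕ Fin (d + 1) →₀ ℕ | Finsupp.weight (bidegree d n) m = (j, q)})
  rw [Nat.card_congr (monomialEquiv d n j q), Nat.card_prod] at h
  simp only [Nat.card_eq_fintype_card, Fintype.card_coe,
    Finset.card_finsuppAntidiag_nat_eq_choose, Finset.card_univ, Fintype.card_fin] at h
  refine h.trans ?_
  rw [mul_comm, Nat.add_right_comm, Nat.add_right_comm n, Nat.add_sub_cancel, Nat.add_sub_cancel,
    add_comm d j, add_comm n q, Nat.choose_symm_add, Nat.choose_symm_add]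

end BigradedSym

end

section

open MvPolynomial

namespace BigradedSym

variable {k : Type} [Field k] {d n : ℕ}

theorem isWeightedHomogeneous_rename_inr {F : MvPolynomial (Fin (d + 1)) k} {j : ℕ}
    (hF : F.IsHomogeneous j) : (rename Sum.inr F : BiPoly k d n) ∈ bihom k d n (j, 0) := by
  intro m hm
  obtain ⟨u, rfl, hu⟩ := coeff_rename_ne_zero _ _ _ hm
  have hw := hF hu
  rw [Finsupp.weight_apply, Finsupp.sum_fintype _ _ (by simp)] at hw
  rw [weight_bidegree, ← hw]
  simp [Finsupp.mapDomain_apply Sum.inr_injective, Finsupp.mapDomain_of_notMem_range]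

theorem columnForm_mem {φ : Matrix (Fin (n + 1)) (Fin n) (MvPolynomial (Fin (d + 1)) k)}
    {μ : Fin n → ℕ} (hφdeg : ∀ a b, (φ a b).IsHomogeneous (μ b)) (b : Fin n) :
    columnForm φ b ∈ bihom k d n (μ b, 1) := by
  refine Submodule.sum_mem _ fun a _ => ?_
  have := (isWeightedHomogeneous_rename_inr (n := n) (hφdeg a b)).mul
    (isWeightedHomogeneous_X k (bidegree d n) (Sum.inl a))
  simpa [bidegree] using this

theorem isHomogeneous_columnIdeal {φ : Matrix (Fin (n + 1)) (Fin n) (MvPolynomial (Fin (d + 1)) k)}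
    {μ : Fin n → ℕ} (hφdeg : ∀ a b, (φ a b).IsHomogeneous (μ b)) (i : ℕ) :
    (columnIdeal φ i).IsHomogeneous (bihom k d n) := by
  refine Ideal.homogeneous_span _ _ ?_
  rintro _ ⟨b, -, rfl⟩
  exact ⟨_, columnForm_mem hφdeg b⟩

theorem columnIdeal_succ (φ : Matrix (Fin (n + 1)) (Fin n) (MvPolynomial (Fin (d + 1)) k))
    (i : Fin n) : columnIdeal φ (i + 1) = columnIdeal φ i ⊔ Ideal.span {columnForm φ i} := by
  rw [columnIdeal, columnIdeal, ← Ideal.span_union, ← Set.image_singleton, ← Set.image_union]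
  congr 2
  ext b
  simp [Fin.ext_iff]
  omega

theorem bihom_le_xIdeal_pow (e : ℕ × ℕ) {F : BiPoly k d n} (hF : F ∈ bihom k d n e) :
    F ∈ xIdeal k d n ^ e.1 := by
  rw [F.as_sum]
  refine Ideal.sum_mem _ fun m hm => ?_
  have hw := hF (mem_support_iff.mp hm)
  rw [weight_bidegree] at hw
  rw [monomial_eq, Finsupp.prod_fintype _ _ (by simp), Fintype.prod_sum_type]
  refine Ideal.mul_mem_left _ _ (Ideal.mul_mem_left _ _ ?_)
  rw [← hw, ← Finset.prod_pow_eq_pow_sum]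
  exact Ideal.prod_mem_prod fun i _ =>
      Ideal.pow_mem_pow (Ideal.subset_span (Set.mem_range_self i)) _

/-- The evaluation `y ↦ f` of bigraded polynomials. -/
noncomputable def evalForms (f : Fin (n + 1) → MvPolynomial (Fin (d + 1)) k) :
    BiPoly k d n →ₐ[k] MvPolynomial (Fin (d + 1)) k :=
  aeval (Sum.elim f X)

theorem evalForms_rename_inr (f : Fin (n + 1) → MvPolynomial (Fin (d + 1)) k)
    (F : MvPolynomial (Fin (d + 1)) k) : evalForms f (rename Sum.inr F) = F := by
  rw [evalForms, aeval_rename, Sum.elim_comp_inr, aeval_X_left_apply]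

theorem map_bihom_le {δ : ℕ} {f : Fin (n + 1) → MvPolynomial (Fin (d + 1)) k}
    (hf : ∀ a, (f a).IsHomogeneous δ) (j q : ℕ) :
    (bihom k d n (j, q)).map (evalForms f).toLinearMap ≤
      ((Ideal.span (Set.range f)) ^ q).restrictScalars k ⊓
        homogeneousSubmodule (Fin (d + 1)) k (j + q * δ) := by
  rintro _ ⟨F, hF, rfl⟩
  rw [F.as_sum, map_sum]
  refine Submodule.sum_mem _ fun m hm => ?_
  have hw := hF (mem_support_iff.mp hm)
  rw [weight_bidegree, Prod.mk.injEq] at hw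
  rw [AlgHom.toLinearMap_apply, evalForms, aeval_monomial,
    Finsupp.prod_fintype _ _ (by simp), Fintype.prod_sum_type]
  simp only [Sum.elim_inl, Sum.elim_inr]
  constructor
  · refine Ideal.mul_mem_left _ _ (Ideal.mul_mem_right _ _ ?_)
    rw [← hw.2, ← Finset.prod_pow_eq_pow_sum]
    exact Ideal.prod_mem_prod fun i _ =>
      Ideal.pow_mem_pow (Ideal.subset_span (Set.mem_range_self i)) _
  · have h1 : (∏ a, f a ^ m (Sum.inl a)).IsHomogeneous (q * δ) := by
      rw [← hw.2, Finset.sum_mul]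
      refine IsHomogeneous.prod _ _ _ fun a _ => ?_
      rw [mul_comm]
      exact (hf a).pow _
    have h2 : (∏ i, (X i : MvPolynomial (Fin (d + 1)) k) ^ m (Sum.inr i)).IsHomogeneous j := by
      rw [← hw.1]
      refine IsHomogeneous.prod _ _ _ fun a _ => ?_
      simpa using (isHomogeneous_X k a).pow (m (Sum.inr a))
    have := (isHomogeneous_C (Fin (d + 1)) (coeff m F)).mul (h1.mul h2)
    rwa [zero_add, add_comm (q * δ)] at this

attribute [local instance] MvPolynomial.gradedAlgebra in
theorem homogeneousComponent_mem_map_bihom {δ : ℕ}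
    {f : Fin (n + 1) → MvPolynomial (Fin (d + 1)) k} (hf : ∀ a, (f a).IsHomogeneous δ) (j q : ℕ)
    {F : MvPolynomial (Fin (d + 1)) k} (hF : F ∈ Ideal.span (Set.range f) ^ q) :
    homogeneousComponent (j + q * δ) F ∈ (bihom k d n (j, q)).map (evalForms f).toLinearMap := by
  induction q generalizing F with
  | zero =>
    refine ⟨rename Sum.inr (homogeneousComponent j F),
      isWeightedHomogeneous_rename_inr (homogeneousComponent_isHomogeneous _ _), ?_⟩
    rw [zero_mul, add_zero]
    exact evalForms_rename_inr _ _
  | succ q ih =>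
    rw [pow_succ'] at hF
    refine Submodule.mul_induction_on hF (fun a ha b hb => ?_) fun a b ha hb => ?_
    · obtain ⟨c, rfl⟩ := Ideal.mem_span_range_iff_exists_fun.mp ha
      rw [Finset.sum_mul, map_sum]
      refine Submodule.sum_mem _ fun i _ => ?_
      obtain ⟨G, hG, hGe⟩ := ih (Ideal.mul_mem_left _ (c i) hb)
      refine ⟨X (Sum.inl i) * G, ?_, ?_⟩
      · have := (isWeightedHomogeneous_X k (bidegree d n) (Sum.inl i)).mul hG
        simpa [bidegree, add_comm] using this
      · rw [mul_comm (c i), mul_assoc, show j + (q + 1) * δ = δ + (j + q * δ) by ring]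
        have hc (i : ℕ) (G : MvPolynomial (Fin (d + 1)) k) :
            (DirectSum.decompose (homogeneousSubmodule (Fin (d + 1)) k) G i : MvPolynomial _ k) =
              homogeneousComponent i G := decomposition.decompose'_apply G i
        rw [← hc, DirectSum.coe_decompose_mul_add_of_left_mem _ (hf i), hc, ← hGe,
          AlgHom.toLinearMap_apply, map_mul, evalForms, aeval_X]
        rfl
    · rw [map_add]
      exact Submodule.add_mem _ ha hb

theorem restrictScalars_pow_inf_homogeneousSubmodule {δ : ℕ}
    {f : Fin (n + 1) → MvPolynomial (Fin (d + 1)) k} (hf : ∀ a, (f a).IsHomogeneous δ) (j q : ℕ) :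
    ((Ideal.span (Set.range f)) ^ q).restrictScalars k ⊓
        homogeneousSubmodule (Fin (d + 1)) k (j + q * δ) =
      (bihom k d n (j, q)).map (evalForms f).toLinearMap := by
  refine le_antisymm ?_ (map_bihom_le hf j q)
  rintro F ⟨hF, hFh⟩
  have := homogeneousComponent_mem_map_bihom hf j q hF
  rwa [homogeneousComponent_of_mem hFh, if_pos rfl] at this

end BigradedSym

end

section

open MvPolynomial

namespace BigradedSym

variable {k : Type} [Field k] {d n : ℕ} {f : Fin (n + 1) → MvPolynomial (Fin (d + 1)) k}
    {φ : Matrix (Fin (n + 1)) (Fin n) (MvPolynomial (Fin (d + 1)) k)} {μ : Fin n → ℕ}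

theorem sum_rename_mulVec_mem_columnIdeal
    (φ : Matrix (Fin (n + 1)) (Fin n) (MvPolynomial (Fin (d + 1)) k))
    (w : Fin n → MvPolynomial (Fin (d + 1)) k) :
    ∑ a, (rename Sum.inr (φ.mulVec w a) : BiPoly k d n) * X (Sum.inl a) ∈ columnIdeal φ n := by
  have : ∑ a, (rename Sum.inr (φ.mulVec w a) : BiPoly k d n) * X (Sum.inl a) =
      ∑ b, rename Sum.inr (w b) * columnForm φ b := by
    simp only [columnForm, Finset.mul_sum, Matrix.mulVec, dotProduct, map_sum, map_mul,
      Finset.sum_mul]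
    rw [Finset.sum_comm]
    exact Finset.sum_congr rfl fun _ _ => Finset.sum_congr rfl fun _ _ => by ring
  rw [this]
  exact Ideal.sum_mem _ fun b _ => Ideal.mul_mem_left _ _
    (Ideal.subset_span ⟨b, b.isLt, rfl⟩)

theorem rename_mul_X_sub_mem_columnIdeal
    (hφ : ∀ v : Fin (n + 1) → MvPolynomial (Fin (d + 1)) k,
      ∑ j, v j * f j = 0 → ∃ w, φ.mulVec w = v) (a : Fin (n + 1)) :
    (rename Sum.inr (f 0) : BiPoly k d n) * X (Sum.inl a) -
      X (Sum.inl 0) * rename Sum.inr (f a) ∈ columnIdeal φ n := by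
  obtain ⟨w, hw⟩ := hφ (Pi.single a (f 0) - Pi.single 0 (f a)) (by
    simp [sub_mul, Finset.sum_sub_distrib, Pi.single_apply, ite_mul, mul_comm (f a)])
  have := sum_rename_mulVec_mem_columnIdeal φ w
  rw [hw] at this
  rw [mul_comm (X (Sum.inl 0))]
  simpa [sub_mul, Finset.sum_sub_distrib, Pi.single_apply, apply_ite (rename Sum.inr),
    ite_mul] using this

theorem rename_pow_mul_sub_mem_columnIdeal
    (hφ : ∀ v : Fin (n + 1) → MvPolynomial (Fin (d + 1)) k,
      ∑ j, v j * f j = 0 → ∃ w, φ.mulVec w = v) {e : ℕ × ℕ} {F : BiPoly k d n}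
    (hF : F ∈ bihom k d n e) :
    rename Sum.inr (f 0) ^ e.2 * F - X (Sum.inl 0) ^ e.2 * rename Sum.inr (evalForms f F) ∈
      columnIdeal φ n := by
  rw [F.as_sum, map_sum, map_sum, Finset.mul_sum, Finset.mul_sum, ← Finset.sum_sub_distrib]
  refine Ideal.sum_mem _ fun m hm => ?_
  have hw := congrArg Prod.snd (hF (mem_support_iff.mp hm))
  rw [weight_bidegree] at hw
  have h (a : Fin (n + 1)) := Ideal.Quotient.eq.mpr (rename_mul_X_sub_mem_columnIdeal hφ a)
  rw [← Ideal.Quotient.eq]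
  simp only [map_mul] at h
  rw [evalForms, aeval_monomial, monomial_eq, Finsupp.prod_fintype _ _ (by simp),
    Finsupp.prod_fintype _ _ (by simp), Fintype.prod_sum_type, Fintype.prod_sum_type, ← hw]
  simp only [Sum.elim_inl, Sum.elim_inr, map_mul, map_prod, map_pow, rename_X, algebraMap_eq,
    rename_C, ← Finset.prod_pow_eq_pow_sum]
  have h' := Finset.prod_congr (s₁ := Finset.univ) rfl fun a (_ : a ∈ Finset.univ) =>
    congrArg (· ^ m (Sum.inl a)) (h a)
  simp only [mul_pow, Finset.prod_mul_distrib] at h'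
  rw [mul_left_comm, mul_left_comm _ (Ideal.Quotient.mk _ (C _))]
  congr 1
  rw [← mul_assoc, ← mul_assoc, h']

theorem columnIdeal_le_ker_evalForms
    (hφ : ∀ b, ∑ a, φ a b * f a = 0) (i : ℕ) :
    columnIdeal φ i ≤ RingHom.ker (evalForms f) := by
  rw [columnIdeal, Ideal.span_le]
  rintro _ ⟨b, -, rfl⟩
  rw [SetLike.mem_coe, RingHom.mem_ker, ← hφ b, columnForm, map_sum]
  refine Finset.sum_congr rfl fun a _ => ?_
  rw [map_mul, evalForms_rename_inr, evalForms, aeval_X, Sum.elim_inl]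

theorem exists_forall_mem_columnIdeal_of_evalForms_eq_zero
    (hφdeg : ∀ a b, (φ a b).IsHomogeneous (μ b))
    (hφ : ∀ v : Fin (n + 1) → MvPolynomial (Fin (d + 1)) k,
      ∑ j, v j * f j = 0 → ∃ w, φ.mulVec w = v)
    (hG : ∀ p : Ideal (MvPolynomial (Fin (d + 1)) k), ∀ _ : p.IsPrime,
      Ideal.span (Set.range f) ≤ p → p.height ≤ d →
      ∃ G : Finset (Localization.AtPrime p), (G.card : ℕ∞) ≤ p.height ∧
        Ideal.span (G : Set (Localization.AtPrime p)) =
          (Ideal.span (Set.range f)).map (algebraMap _ (Localization.AtPrime p)))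
    (hf0 : f 0 ≠ 0) :
    ∃ j, ∀ e : ℕ × ℕ, j ≤ e.1 → ∀ F ∈ bihom k d n e, evalForms f F = 0 → F ∈ columnIdeal φ n := by
  obtain ⟨j, hj⟩ := exists_mem_columnIdeal_of_pow_mul_mem hφdeg hφ hG hf0
  refine ⟨j, fun e he F hF hF0 =>
    hj F (Ideal.pow_le_pow_right he (bihom_le_xIdeal_pow e hF)) e.2 ?_⟩
  simpa [hF0] using rename_pow_mul_sub_mem_columnIdeal hφ hF

theorem exists_forall_finrank_add_finrank_eq (hφdeg : ∀ a b, (φ a b).IsHomogeneous (μ b))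
    (hφ : ∀ v : Fin (n + 1) → MvPolynomial (Fin (d + 1)) k,
      ∑ j, v j * f j = 0 ↔ ∃ w, φ.mulVec w = v)
    (hG : ∀ p : Ideal (MvPolynomial (Fin (d + 1)) k), ∀ _ : p.IsPrime,
      Ideal.span (Set.range f) ≤ p → p.height ≤ d →
      ∃ G : Finset (Localization.AtPrime p), (G.card : ℕ∞) ≤ p.height ∧
        Ideal.span (G : Set (Localization.AtPrime p)) =
          (Ideal.span (Set.range f)).map (algebraMap _ (Localization.AtPrime p)))
    (hf0 : f 0 ≠ 0) {δ : ℕ} (hf : ∀ a, (f a).IsHomogeneous δ) :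
    ∃ j₀, ∀ j q, j₀ ≤ j →
      Module.finrank k ↥(((Ideal.span (Set.range f)) ^ q).restrictScalars k ⊓
        homogeneousSubmodule (Fin (d + 1)) k (j + q * δ)) +
      Module.finrank k ↥((columnIdeal φ n).restrictScalars k ⊓ bihom k d n (j, q)) =
      Module.finrank k (bihom k d n (j, q)) := by
  obtain ⟨j₀, h⟩ := exists_forall_mem_columnIdeal_of_evalForms_eq_zero hφdeg
    (fun v => (hφ v).mp) hG hf0
  refine ⟨j₀, fun j q hj => ?_⟩
  rw [restrictScalars_pow_inf_homogeneousSubmodule hf,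
    ← Submodule.finrank_map_add_finrank_inf_ker (bihom k d n (j, q)) (evalForms f).toLinearMap]
  congr 1
  have hle := columnIdeal_le_ker_evalForms (f := f) (φ := φ) (fun b => (hφ fun a => φ a b).mpr
    ⟨Pi.single b 1, by ext1 a; simp⟩) n
  refine congrArg (fun V : Submodule k (BiPoly k d n) => Module.finrank k V) ?_
  rw [inf_comm]
  ext F
  exact and_congr_right fun hF => ⟨fun h' => hle h', fun h' => h _ hj F hF h'⟩

end BigradedSym

end

section

open MvPolynomial

namespace BigradedSym

variable {k : Type} [Field k] {d n : ℕ} {f : Fin (n + 1) → MvPolynomial (Fin (d + 1)) k}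
    {φ : Matrix (Fin (n + 1)) (Fin n) (MvPolynomial (Fin (d + 1)) k)} {μ : Fin n → ℕ}

/-- The bigraded Hilbert function of the quotient by `columnIdeal φ i`. -/
noncomputable def quotientHilbFn (φ : Matrix (Fin (n + 1)) (Fin n) (MvPolynomial (Fin (d + 1)) k))
    (i j q : ℕ) : ℚ :=
  Module.finrank k (bihom k d n (j, q)) -
    Module.finrank k ↥((columnIdeal φ i).restrictScalars k ⊓ bihom k d n (j, q))

theorem quotientHilbFn_zero (φ : Matrix (Fin (n + 1)) (Fin n) (MvPolynomial (Fin (d + 1)) k))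
    (j q : ℕ) :
    quotientHilbFn φ 0 j q = (j + d).choose d * (q + n).choose n := by
  have : columnIdeal φ 0 = ⊥ := by simp [columnIdeal]
  rw [quotientHilbFn, this, Submodule.restrictScalars_bot, bot_inf_eq, finrank_bot, finrank_bihom]
  simp

theorem exists_forall_quotientHilbFn_succ (hφdeg : ∀ a b, (φ a b).IsHomogeneous (μ b))
    (hφ : ∀ v : Fin (n + 1) → MvPolynomial (Fin (d + 1)) k,
      ∑ j, v j * f j = 0 → ∃ w, φ.mulVec w = v)
    (hG : ∀ p : Ideal (MvPolynomial (Fin (d + 1)) k), ∀ _ : p.IsPrime,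
      Ideal.span (Set.range f) ≤ p → p.height ≤ d →
      ∃ G : Finset (Localization.AtPrime p), (G.card : ℕ∞) ≤ p.height ∧
        Ideal.span (G : Set (Localization.AtPrime p)) =
          (Ideal.span (Set.range f)).map (algebraMap _ (Localization.AtPrime p)))
    (i : Fin n) :
    ∃ j₀, ∀ j q, j₀ ≤ j → quotientHilbFn φ (i + 1) (μ i + j) (1 + q) =
      quotientHilbFn φ i (μ i + j) (1 + q) - quotientHilbFn φ i j q := by
  obtain ⟨j₀, h⟩ := exists_mem_columnIdeal_of_mul_mem hφdeg hφ hG i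
  refine ⟨j₀, fun j q hj => ?_⟩
  have := GradedAlgebra.finrank_sup_span_inf (bihom k d n) (isHomogeneous_columnIdeal hφdeg i)
    (columnForm_mem hφdeg i) (e := (j, q)) fun t ht =>
      h t (Ideal.pow_le_pow_right hj (bihom_le_xIdeal_pow _ ht))
  rw [← columnIdeal_succ, Prod.mk_add_mk] at this
  have := congrArg (Nat.cast : ℕ → ℚ) this
  push_cast at this
  simp only [quotientHilbFn]
  linarith

end BigradedSym

end

section

open MvPolynomial

namespace MvPolynomial

variable {σ K : Type*} [CommRing K]

theorem X_mul_mem_restrictSupport {c N : ℕ} {P : MvPolynomial σ K}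
    (hP : P ∈ restrictSupport K {t : σ →₀ ℕ | t.degree + c ≤ N}) (i : σ) :
    X i * P ∈ restrictSupport K {t : σ →₀ ℕ | t.degree + c ≤ N + 1} := by
  classical
  rw [mem_restrictSupport_iff] at hP ⊢
  intro t ht
  rw [Finset.mem_coe, support_X_mul, Finset.mem_map] at ht
  obtain ⟨s, hs, rfl⟩ := ht
  have : s.degree + c ≤ N := hP hs
  simp only [Set.mem_ofPred_eq, addLeftEmbedding_apply, map_add, Finsupp.degree_single]
  omega

theorem eval_aeval_X_sub_C (c x : σ → K) (P : MvPolynomial σ K) :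
    eval x (aeval (fun i => X i - C (c i)) P) = eval (x - c) P := by
  rw [← aeval_eq_eval, ← aeval_eq_eval, ← AlgHom.comp_apply, comp_aeval]
  congr 2
  ext i
  simp

variable [Fintype σ]

theorem monomial_sub_shift_mem_restrictSupport (c : σ → K) (N : ℕ) (s : σ →₀ ℕ)
    (hs : s.degree = N) :
    (monomial s 1 - aeval (fun i => X i - C (c i)) (monomial s (1 : K)) ∈
      restrictSupport K {t : σ →₀ ℕ | t.degree + 1 ≤ N}) ∧
    monomial s 1 - aeval (fun i => X i - C (c i)) (monomial s (1 : K)) -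
        ∑ i, C (c i) * pderiv i (monomial s 1) ∈
      restrictSupport K {t : σ →₀ ℕ | t.degree + 2 ≤ N} := by
  classical
  induction N generalizing s with
  | zero =>
    obtain rfl : s = 0 := (Finsupp.degree_eq_zero_iff s).mp hs
    simp [← C_apply]
  | succ N ih =>
    obtain ⟨i, hi⟩ : ∃ i, s i ≠ 0 := by
      by_contra! h
      obtain rfl : s = 0 := Finsupp.ext h
      simp at hs
    obtain ⟨s, rfl⟩ : ∃ s', s = Finsupp.single i 1 + s' :=
      ⟨s - Finsupp.single i 1, (add_tsub_cancel_of_le (Finsupp.single_le_iff.mpr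
        (Nat.one_le_iff_ne_zero.mpr hi))).symm⟩
    obtain ⟨h1, h2⟩ := ih s (by simp at hs; omega)
    rw [show monomial (Finsupp.single i 1 + s) (1 : K) = X i * monomial s 1 by
      rw [X, monomial_mul, one_mul]]
    set Q := monomial s (1 : K)
    have hQ : Q ∈ restrictSupport K {t : σ →₀ ℕ | t.degree ≤ N} :=
      (monomial_mem_restrictSupport _).mpr (Or.inl (by simp at hs ⊢; omega))
    simp only [map_mul, aeval_X, Derivation.leibniz, smul_eq_mul, pderiv_X, mul_add,
      Finset.sum_add_distrib]
    constructor
    · rw [show X i * Q - (X i - C (c i)) * aeval (fun i => X i - C (c i)) Q =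
        X i * (Q - aeval (fun i => X i - C (c i)) Q) +
          c i • (Q - (Q - aeval (fun i => X i - C (c i)) Q)) by rw [smul_eq_C_mul]; ring]
      have h1' := restrictSupport_mono K (t := {t : σ →₀ ℕ | t.degree ≤ N}) (by
        intro t ht
        simp only [Set.mem_ofPred_eq] at ht ⊢
        omega) h1
      refine Submodule.add_mem _ (X_mul_mem_restrictSupport h1 i) (Submodule.smul_mem _ _ ?_)
      simpa using Submodule.sub_mem _ hQ h1'
    · have : ∑ j, C (c j) * (Q * Pi.single (M := fun _ => MvPolynomial σ K) j 1 i) = c i • Q := by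
        rw [Finset.sum_eq_single i (by intro j _ h; simp [h.symm]) (by simp), Pi.single_eq_same,
          mul_one, smul_eq_C_mul]
      have hs' : ∑ j, C (c j) * (X i * pderiv j Q) = X i * ∑ j, C (c j) * pderiv j Q := by
        rw [Finset.mul_sum]
        exact Finset.sum_congr rfl fun _ _ => mul_left_comm _ _ _
      rw [this, hs', show X i * Q - (X i - C (c i)) * aeval (fun i => X i - C (c i)) Q -
          (X i * ∑ j, C (c j) * pderiv j Q + c i • Q) =
        X i * (Q - aeval (fun i => X i - C (c i)) Q - ∑ j, C (c j) * pderiv j Q) -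
          c i • (Q - aeval (fun i => X i - C (c i)) Q) by simp only [smul_eq_C_mul]; ring]
      refine Submodule.sub_mem _ (X_mul_mem_restrictSupport h2 i) (Submodule.smul_mem _ _ ?_)
      refine restrictSupport_mono K (fun t (ht : t.degree + 1 ≤ N) => ?_) h1
      exact Nat.succ_le_succ ht

/-- Subtracting a translate lowers the degree, and the top part of the difference is given by the
directional derivative. -/
theorem sub_shift_mem_restrictSupport (c : σ → K) {N : ℕ} {P : MvPolynomial σ K}
    (hP : P ∈ restrictSupport K {t : σ →₀ ℕ | t.degree ≤ N}) :
    (P - aeval (fun i => X i - C (c i)) P ∈ restrictSupport K {t : σ →₀ ℕ | t.degree + 1 ≤ N}) ∧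
    P - aeval (fun i => X i - C (c i)) P - ∑ i, C (c i) * pderiv i P ∈
      restrictSupport K {t : σ →₀ ℕ | t.degree + 2 ≤ N} := by
  let L₁ : MvPolynomial σ K →ₗ[K] MvPolynomial σ K :=
    LinearMap.id - (aeval fun i => X i - C (c i)).toLinearMap
  let L₂ : MvPolynomial σ K →ₗ[K] MvPolynomial σ K :=
    L₁ - ∑ i, LinearMap.mulLeft K (C (c i)) ∘ₗ (pderiv i).toLinearMap
  have hL₂ (Q) : L₂ Q = Q - aeval (fun i => X i - C (c i)) Q - ∑ i, C (c i) * pderiv i Q := by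
    simp [L₁, L₂]
  have h : restrictSupport K {t : σ →₀ ℕ | t.degree ≤ N} ≤
      (restrictSupport K {t : σ →₀ ℕ | t.degree + 1 ≤ N}).comap L₁ ⊓
        (restrictSupport K {t : σ →₀ ℕ | t.degree + 2 ≤ N}).comap L₂ := by
    rw [restrictSupport_eq_span, Submodule.span_le]
    rintro _ ⟨s, hs, rfl⟩
    obtain ⟨h1, h2⟩ := monomial_sub_shift_mem_restrictSupport c _ s rfl
    have hs : s.degree ≤ N := hs
    have mono (e : ℕ) : restrictSupport K {t : σ →₀ ℕ | t.degree + e ≤ s.degree} ≤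
        restrictSupport K {t : σ →₀ ℕ | t.degree + e ≤ N} :=
      restrictSupport_mono K fun t (ht : t.degree + e ≤ s.degree) => ht.trans hs
    exact ⟨mono 1 h1, mono 2 ((hL₂ _).symm ▸ h2)⟩
  exact ⟨(h hP).1, hL₂ P ▸ (h hP).2⟩

theorem coeff_sub_shift (c : σ → K) {N : ℕ} {P : MvPolynomial σ K}
    (hP : P ∈ restrictSupport K {t : σ →₀ ℕ | t.degree ≤ N}) {t : σ →₀ ℕ} (ht : t.degree + 1 = N) :
    coeff t (P - aeval (fun i => X i - C (c i)) P) =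
      ∑ i, c i * ((t i + 1) * coeff (t + Finsupp.single i 1) P) := by
  have h := (mem_restrictSupport_iff K).mp (sub_shift_mem_restrictSupport c hP).2
  have : coeff t (P - aeval (fun i => X i - C (c i)) P - ∑ i, C (c i) * pderiv i P) = 0 := by
    by_contra h'
    have : t.degree + 2 ≤ N := h (mem_support_iff.mpr h')
    omega
  rw [coeff_sub, sub_eq_zero] at this
  rw [this, coeff_sum]
  refine Finset.sum_congr rfl fun i _ => ?_
  rw [coeff_C_mul, coeff_pderiv, mul_comm (coeff _ P)]

end MvPolynomial

end

section

open MvPolynomial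

/-- The coefficient of `u ^ a * v ^ b` multiplied by `a! * b!`. -/
noncomputable def MvPolynomial.normalizedCoeff (Q : MvPolynomial (Fin 2) ℚ) (a b : ℕ) : ℚ :=
  (a.factorial * b.factorial : ℚ) * coeff (Finsupp.single 0 a + Finsupp.single 1 b) Q

namespace MvPolynomial

theorem exists_eval_eq_choose_mul_choose (d n : ℕ) : ∃ Q : MvPolynomial (Fin 2) ℚ,
    Q ∈ restrictSupport ℚ {t : Fin 2 →₀ ℕ | t.degree ≤ d + n} ∧
    (∀ j q : ℕ, eval ![(j : ℚ), (q : ℚ)] Q = (j + d).choose d * (q + n).choose n) ∧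
    ∀ a b, a + b = d + n → normalizedCoeff Q a b = if a = d then 1 else 0 := by
  classical
  let B (e : ℕ) : Polynomial ℚ := Polynomial.preHilbertPoly ℚ e 0
  have hB (e j : ℕ) :
      ∑ i ∈ Finset.range (e + 1), (B e).coeff i * (j : ℚ) ^ i = (j + e).choose e := by
    have := Polynomial.preHilbertPoly_eq_choose_sub_add ℚ e (Nat.zero_le j)
    rwa [Polynomial.eval_eq_sum_range, Polynomial.natDegree_preHilbertPoly] at this
  have hinj (i j a b : ℕ) : Finsupp.single (0 : Fin 2) i + Finsupp.single 1 j =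
      Finsupp.single 0 a + Finsupp.single 1 b ↔ i = a ∧ j = b := by
    simp [Finsupp.ext_iff, Fin.forall_fin_two]
  refine ⟨∑ i ∈ Finset.range (d + 1), ∑ j ∈ Finset.range (n + 1),
    monomial (Finsupp.single 0 i + Finsupp.single 1 j) ((B d).coeff i * (B n).coeff j), ?_, ?_, ?_⟩
  · refine Submodule.sum_mem _ fun i hi => Submodule.sum_mem _ fun j hj => ?_
    rw [Finset.mem_range] at hi hj
    refine (monomial_mem_restrictSupport _).mpr (Or.inl ?_)
    simp
    omega
  · intro j q
    rw [← hB, ← hB, Finset.sum_mul_sum, map_sum]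
    refine Finset.sum_congr rfl fun a _ => ?_
    rw [map_sum]
    refine Finset.sum_congr rfl fun b _ => ?_
    rw [eval_monomial, Finsupp.prod_fintype _ _ (by simp)]
    simp
    ring
  · intro a b hab
    simp only [normalizedCoeff, coeff_sum, coeff_monomial, hinj, ite_and]
    split_ifs with h
    · obtain rfl := h
      obtain rfl : b = n := by omega
      simp [B, Polynomial.coeff_preHilbertPoly_self]
      field_simp
    · refine mul_eq_zero_of_right _ (Finset.sum_eq_zero fun i hi =>
        Finset.sum_eq_zero fun j hj => ?_)
      rw [Finset.mem_range] at hi hj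
      rw [ite_eq_right_iff, ite_eq_right_iff]
      omega

theorem normalizedCoeff_sub_shift {N : ℕ} (m : ℚ) {Q : MvPolynomial (Fin 2) ℚ}
    (hQ : Q ∈ restrictSupport ℚ {t : Fin 2 →₀ ℕ | t.degree ≤ N + 1}) {a b : ℕ} (hab : a + b = N) :
    normalizedCoeff (Q - aeval (fun i => X i - C ((![m, 1] : Fin 2 → ℚ) i)) Q) a b =
      m * normalizedCoeff Q (a + 1) b + normalizedCoeff Q a (b + 1) := by
  rw [normalizedCoeff, coeff_sub_shift _ hQ (by simp [hab]), Fin.sum_univ_two, normalizedCoeff,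
    normalizedCoeff, add_right_comm, ← Finsupp.single_add, add_assoc, ← Finsupp.single_add,
    Nat.factorial_succ, Nat.factorial_succ]
  simp
  ring

theorem exists_eval_eq_of_recursion (d n : ℕ) (μ : Fin n → ℕ) (h : ℕ → ℕ → ℕ → ℚ)
    (h0 : ∀ j q, h 0 j q = (j + d).choose d * (q + n).choose n)
    (hs : ∀ i : Fin n, ∃ j₀, ∀ j q, j₀ ≤ j → h (i + 1) (μ i + j) (1 + q) =
      h i (μ i + j) (1 + q) - h i j q) (i : ℕ) (hi : i ≤ n) :
    ∃ Q : MvPolynomial (Fin 2) ℚ,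
      Q ∈ restrictSupport ℚ {t : Fin 2 →₀ ℕ | t.degree ≤ d + n - i} ∧
      (∃ j₀ q₀ : ℕ, ∀ j q : ℕ, j₀ ≤ j → q₀ ≤ q → eval ![(j : ℚ), (q : ℚ)] Q = h i j q) ∧
      ∀ a b, a + b = d + n - i → normalizedCoeff Q a b =
        if a ≤ d then ∑ s ∈ Finset.powersetCard (d - a) (Finset.univ.filter fun b : Fin n => b < i),
          ∏ j ∈ s, (μ j : ℚ) else 0 := by
  induction i with
  | zero =>
    obtain ⟨Q, hQ, hQe, hQc⟩ := exists_eval_eq_choose_mul_choose d n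
    refine ⟨Q, hQ, ⟨0, 0, fun j q _ _ => by rw [hQe, h0]⟩, fun a b hab => ?_⟩
    rw [hQc a b hab]
    rcases lt_trichotomy a d with had | rfl | had
    · obtain ⟨e, rfl⟩ := Nat.exists_eq_add_of_lt had
      simp [add_assoc, Finset.powersetCard_eq_empty.mpr
        (show (∅ : Finset (Fin n)).card < e + 1 by simp)]
    · simp
    · simp [had.ne', had.not_ge]
  | succ i ih =>
    obtain ⟨Q, hQ, ⟨j₀, q₀, hQe⟩, hQc⟩ := ih (by omega)
    obtain ⟨j₁, hj₁⟩ := hs ⟨i, hi⟩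
    set m := μ ⟨i, hi⟩
    rw [show d + n - i = d + n - (i + 1) + 1 by omega] at hQ
    refine ⟨Q - aeval (fun i => X i - C ((![(m : ℚ), 1] : Fin 2 → ℚ) i)) Q, ?_,
      ⟨m + j₀ + j₁, 1 + q₀, fun j q hj hq => ?_⟩, fun a b hab => ?_⟩
    · simpa only [Nat.add_le_add_iff_right] using (sub_shift_mem_restrictSupport ![(m : ℚ), 1] hQ).1
    · obtain ⟨j, rfl⟩ := Nat.exists_eq_add_of_le (show m ≤ j by omega)
      obtain ⟨q, rfl⟩ := Nat.exists_eq_add_of_le (show 1 ≤ q by omega)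
      rw [hj₁ j q (by omega), map_sub, eval_aeval_X_sub_C, hQe _ _ (by omega) (by omega)]
      congr 1
      rw [← hQe j q (by omega) (by omega)]
      congr 2
      ext i
      fin_cases i <;> simp
    · rw [normalizedCoeff_sub_shift _ hQ hab, hQc _ _ (by omega), hQc _ _ (by omega)]
      have hins : (Finset.univ.filter fun b : Fin n => (b : ℕ) < i + 1) =
          insert ⟨i, hi⟩ (Finset.univ.filter fun b : Fin n => (b : ℕ) < i) := by
        ext b
        simp [Fin.ext_iff]
        omega
      have hmem {e : ℕ} {s : Finset (Fin n)} (hs : s ∈ Finset.powersetCard e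
          (Finset.univ.filter fun b : Fin n => (b : ℕ) < i)) : (⟨i, hi⟩ : Fin n) ∉ s := fun h => by
        simpa using (Finset.mem_powersetCard.mp hs).1 h
      rcases lt_trichotomy a d with had | rfl | had
      · obtain ⟨e, rfl⟩ := Nat.exists_eq_add_of_lt had
        rw [if_pos (by omega), if_pos (by omega), if_pos (by omega), hins,
          show a + e + 1 - a = e + 1 by omega, show a + e + 1 - (a + 1) = e by omega,
          Finset.powersetCard_succ_insert (by simp), Finset.sum_union, Finset.sum_image, add_comm,
          Finset.mul_sum]
        · congr 1
          exact Finset.sum_congr rfl fun s hs =>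
            (Finset.prod_insert (f := fun j => (μ j : ℚ)) (hmem hs)).symm
        · intro s hs t ht hst
          rw [← Finset.erase_insert (hmem hs), hst, Finset.erase_insert (hmem ht)]
        · rw [Finset.disjoint_left]
          intro s hs hs'
          obtain ⟨t, -, rfl⟩ := Finset.mem_image.mp hs'
          exact hmem hs (Finset.mem_insert_self _ _)
      · simp
      · rw [if_neg (by omega), if_neg (by omega), if_neg (by omega)]
        simp

theorem eq_of_forall_eval_natCast_eq {P Q : MvPolynomial (Fin 2) ℚ} {j₀ q₀ : ℕ}
    (h : ∀ j q : ℕ, j₀ ≤ j → q₀ ≤ q → eval ![(j : ℚ), (q : ℚ)] P = eval ![(j : ℚ), (q : ℚ)] Q) :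
    P = Q := by
  have hinf (m : ℕ) : ((Nat.cast : ℕ → ℚ) '' Set.Ici m).Infinite :=
    (Set.Ici_infinite m).image Nat.cast_injective.injOn
  refine funext_set ![Nat.cast '' Set.Ici j₀, Nat.cast '' Set.Ici q₀]
    (by rintro i; fin_cases i <;> exact hinf _) fun x hx => ?_
  obtain ⟨j, hj, hj'⟩ := hx 0 trivial
  obtain ⟨q, hq, hq'⟩ := hx 1 trivial
  have : x = ![(j : ℚ), (q : ℚ)] := by
    ext i
    fin_cases i
    exacts [hj'.symm, hq'.symm]
  rw [this, h j q hj hq]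

end MvPolynomial

end

section

variable {d : ℕ} (k : Type) [Field k]

/-- **Projective degrees for perfect ideals of height two** (Theorem 5.6 / Theorem B).
Suppose `I = (f₀,…,f_n)` is a perfect ideal of height two with Hilbert–Burch resolution
`0 → ⊕ᵢ R(−δ−μᵢ) →^φ R(−δ)^{n+1} → I → 0` and satisfying `G_{d+1}`.  Then for `0 ≤ i ≤ d`,
`d_i(F) = e_{d-i}(μ₁,…,μ_n)`, the elementary symmetric polynomial of degree `d − i`. -/
theorem projDeg_perfect_height_two
    {n : ℕ} (hdn : d ≤ n) (δ : ℕ) (hδ : 0 < δ)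
    (f : Fin (n + 1) → MvPolynomial (Fin (d + 1)) k)
    (hf : ∀ j, f j ≠ 0 ∧ (f j).IsHomogeneous δ)
    (P : MvPolynomial (Fin 2) ℚ)
    (hP : IsBigradedHilbPoly (reesHilbFn k δ f) P)
    (hPdeg : P.totalDegree = d)
    (hht : idealHeight (Ideal.span (Set.range f)) = (2 : ℕ∞))
    (μ : Fin n → ℕ) (hμ : ∀ i, 1 ≤ μ i)
    (φ : Matrix (Fin (n + 1)) (Fin n) (MvPolynomial (Fin (d + 1)) k))
    (hφdeg : ∀ a b, (φ a b).IsHomogeneous (μ b))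
    (hφinj : Function.Injective φ.mulVec)
    (hker : ∀ v : Fin (n + 1) → MvPolynomial (Fin (d + 1)) k,
      (∑ j, v j * f j = 0) ↔ ∃ w : Fin n → MvPolynomial (Fin (d + 1)) k, φ.mulVec w = v)
    (hG : CondG (d + 1) (Ideal.span (Set.range f))) :
    ∀ i : ℕ, i ≤ d →
      projDeg d P i =
        ∑ s ∈ Finset.powersetCard (d - i) (Finset.univ : Finset (Fin n)),
          ∏ j ∈ s, (μ j : ℚ) := by
  have hG' : ∀ p : Ideal (MvPolynomial (Fin (d + 1)) k), ∀ _ : p.IsPrime,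
      Ideal.span (Set.range f) ≤ p → p.height ≤ d →
      ∃ G : Finset (Localization.AtPrime p), (G.card : ℕ∞) ≤ p.height ∧
        Ideal.span (G : Set (Localization.AtPrime p)) =
          (Ideal.span (Set.range f)).map (algebraMap _ (Localization.AtPrime p)) := by
    intro p hp hIp hpd
    have hlt : p.height < ((d + 1 : ℕ) : ℕ∞) := hpd.trans_lt (by norm_cast; omega)
    have h := hG ⟨p, hp⟩ hIp
    rw [← PrimeSpectrum.height_eq_orderHeight] at h
    exact exists_finset_card_le_of_minGens_le hlt.ne_top (h hlt)
  obtain ⟨Q, -, ⟨j₁, q₁, hQ⟩, hQc⟩ := MvPolynomial.exists_eval_eq_of_recursion d n μ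
    (BigradedSym.quotientHilbFn φ) (BigradedSym.quotientHilbFn_zero φ)
    (BigradedSym.exists_forall_quotientHilbFn_succ hφdeg (fun v => (hker v).mp) hG') n le_rfl
  obtain ⟨j₂, hrees⟩ := BigradedSym.exists_forall_finrank_add_finrank_eq hφdeg hker hG'
    (hf 0).1 fun a => (hf a).2
  obtain ⟨j₀, q₀, hP⟩ := hP
  obtain rfl : P = Q := MvPolynomial.eq_of_forall_eval_natCast_eq (j₀ := j₀ + j₁ + j₂)
    (q₀ := q₀ + q₁) fun j q hj hq => by
      rw [hP j q (by omega) (by omega), hQ j q (by omega) (by omega), BigradedSym.quotientHilbFn,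
        ← hrees j q (by omega)]
      simp [reesHilbFn]
  intro i hi
  have h := hQc i (d - i) (by omega)
  simp only [if_pos hi, Fin.is_lt, Finset.filter_true] at h
  exact h

end
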